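/- arXiv:2306.11613 — 4 statements merged into one kernel-verified Lean document; each statement's English description precedes it below -/
import Mathlib

section
/- There exists an absolute constant c > 0 such that for any disjoint closed intervals I₁,…,I_s ⊂ ℝ with minimal gap σ and diameter D of their union, and any y₁,…,y_s ∈ [−1,1] and n ∈ ℕ, there is a polynomial P of degree ≤ n with ‖P‖ ≤ 1 on the convex hull of ∪I_i and |P(t) − y_i| ≤ 2·exp(−c·n·σ/D) for all t ∈ I_i, all i. -/
open Polynomial Set Real

/-- A real polynomial has a polynomial primitive of degree at most one more. -/
theorem exists_polynomial_primitive (K : ℝ[X]) :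
    ∃ F : ℝ[X], F.natDegree ≤ K.natDegree + 1 ∧
      ∀ u v : ℝ, ∫ x in u..v, K.eval x = F.eval v - F.eval u := by
  let F : ℝ[X] := ∑ k ∈ Finset.range (K.natDegree + 1),
    Polynomial.C (K.coeff k / (k + 1)) * X ^ (k + 1)
  refine ⟨F, ?_, fun u v => ?_⟩
  · refine natDegree_sum_le_of_forall_le _ _ fun k hk => ?_
    exact (natDegree_C_mul_X_pow_le _ _).trans (Finset.mem_range.1 hk)
  · refine intervalIntegral.integral_eq_sub_of_hasDerivAt (f := fun x => F.eval x) (fun x _ => ?_)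
      (K.continuous.intervalIntegrable _ _)
    have h : F.derivative = K := by
      conv_rhs => rw [K.as_sum_range_C_mul_X_pow]
      simp only [F, derivative_sum]
      refine Finset.sum_congr rfl fun k _ => ?_
      rw [derivative_C_mul_X_pow]
      congr 2
      push_cast
      field_simp
    simpa [h] using F.hasDerivAt x

open MeasureTheory in
/-- Convolving a step function with a concentrated nonnegative polynomial kernel gives a bounded
polynomial that nearly takes prescribed values on separated intervals. -/
theorem exists_polynomial_of_kernel {ι : Type*} [Fintype ι] (K : ℝ[X]) (hK : ∀ v, 0 ≤ K.eval v)
    {A δ ε : ℝ} (hδ : 0 ≤ δ) (hpos : 0 < ∫ v in -A..A, K.eval v)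
    (htail : (1 - ε) * ∫ v in -A..A, K.eval v ≤ ∫ v in -δ..δ, K.eval v)
    {a b : ι → ℝ} (hab : ∀ i, a i ≤ b i)
    (hgap : ∀ i j, i ≠ j → b i + 2 * δ ≤ a j ∨ b j + 2 * δ ≤ a i)
    {S : Set ℝ} (hS : ∀ x ∈ S, ∀ i, -A ≤ x - b i - δ ∧ x - a i + δ ≤ A)
    {y : ι → ℝ} (hy : ∀ i, |y i| ≤ 1) :
    ∃ P : ℝ[X], P.natDegree ≤ K.natDegree + 1 ∧ (∀ x ∈ S, |P.eval x| ≤ 1) ∧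
      ∀ i, ∀ x ∈ Icc (a i) (b i), x ∈ S → |P.eval x - y i| ≤ 2 * ε := by
  classical
  obtain ⟨F, hFdeg, hF⟩ := exists_polynomial_primitive K
  set κ := ∫ v in -A..A, K.eval v with hκ
  let w : ι → ℝ → ℝ := fun i x => (∫ v in (x - b i - δ)..(x - a i + δ), K.eval v) / κ
  let P : ℝ[X] := ∑ i, Polynomial.C (y i / κ) *
    (F.comp (X - Polynomial.C (a i - δ)) - F.comp (X - Polynomial.C (b i + δ)))
  have hP : ∀ x, P.eval x = ∑ i, y i * w i x := by
    intro x
    simp only [P, w, eval_finsetSum, hF]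
    refine Finset.sum_congr rfl fun i _ => ?_
    simp only [eval_mul, eval_C, eval_sub, eval_comp, eval_X]
    rw [show x - (a i - δ) = x - a i + δ by ring, show x - (b i + δ) = x - b i - δ by ring]
    ring
  have hle : ∀ i x, x - b i - δ ≤ x - a i + δ := fun i x => by linarith [hab i]
  have hw : ∀ i x, 0 ≤ w i x := fun i x =>
    div_nonneg (intervalIntegral.integral_nonneg (hle i x) fun v _ => hK v) hpos.le
  have hsum : ∀ x ∈ S, ∑ i, w i x ≤ 1 := by
    intro x hx
    simp only [w]
    rw [← Finset.sum_div, div_le_one hpos]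
    have hA : -A ≤ A := by
      by_contra! h
      have := intervalIntegral.integral_nonneg (μ := volume) h.le fun v _ => hK v
      rw [intervalIntegral.integral_symm] at this
      linarith
    simp_rw [fun i => intervalIntegral.integral_of_le (μ := volume)
      (f := fun v => K.eval v) (hle i x)]
    rw [hκ, intervalIntegral.integral_of_le hA, ← integral_iUnion_fintype]
    · refine setIntegral_mono_set ?_ (Filter.Eventually.of_forall fun v => hK v)
        (Filter.Eventually.of_forall ?_)
      · exact (K.continuous.intervalIntegrable (-A) A).1
      · refine iUnion_subset fun i => ?_
        exact Ioc_subset_Ioc (hS x hx i).1 (hS x hx i).2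
    · exact fun i => measurableSet_Ioc
    · intro i j hij
      refine Set.disjoint_left.2 fun v hv hv' => ?_
      rcases hgap i j hij with h | h <;> linarith [hv.1, hv.2, hv'.1, hv'.2]
    · exact fun i => (K.continuous.intervalIntegrable _ _).1
  refine ⟨P, ?_, fun x hx => ?_, fun i x hxi hx => ?_⟩
  · refine natDegree_sum_le_of_forall_le _ _ fun i _ => ?_
    have hcomp : ∀ r : ℝ, (F.comp (X - Polynomial.C r)).natDegree ≤ K.natDegree + 1 := fun r => by
      rw [natDegree_comp, natDegree_X_sub_C, mul_one]; exact hFdeg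
    exact (natDegree_C_mul_le _ _).trans 
      ((natDegree_sub_le_of_le (hcomp _) (hcomp _)).trans_eq (max_self _))
  · rw [hP]
    calc |∑ i, y i * w i x| ≤ ∑ i, |y i * w i x| := Finset.abs_sum_le_sum_abs _ _
      _ ≤ ∑ i, w i x := Finset.sum_le_sum fun i _ => by
        rw [abs_mul, abs_of_nonneg (hw i x)]
        exact mul_le_of_le_one_left (hw i x) (hy i)
      _ ≤ 1 := hsum x hx
  · have hwi : 1 - ε ≤ w i x := by
      rw [le_div_iff₀ hpos]
      refine htail.trans (intervalIntegral.integral_mono_interval ?_ ?_ ?_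
        (Filter.Eventually.of_forall fun v => hK v) (K.continuous.intervalIntegrable _ _))
      · linarith [hxi.2]
      · linarith
      · linarith [hxi.1]
    have hrest : ∑ j ∈ Finset.univ.erase i, w j x ≤ ε := by
      have := Finset.add_sum_erase Finset.univ (fun j => w j x) (Finset.mem_univ i)
      linarith [hsum x hx]
    have hwi1 : w i x ≤ 1 :=
      (Finset.single_le_sum (fun j _ => hw j x) (Finset.mem_univ i)).trans (hsum x hx)
    rw [hP, ← Finset.add_sum_erase _ _ (Finset.mem_univ i)]
    calc |y i * w i x + ∑ j ∈ Finset.univ.erase i, y j * w j x - y i|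
        = |y i * (w i x - 1) + ∑ j ∈ Finset.univ.erase i, y j * w j x| := by ring_nf
      _ ≤ |y i * (w i x - 1)| + |∑ j ∈ Finset.univ.erase i, y j * w j x| := abs_add_le _ _
      _ ≤ (1 - w i x) + ∑ j ∈ Finset.univ.erase i, w j x := by
        gcongr
        · rw [abs_mul, abs_of_nonpos (by linarith : w i x - 1 ≤ 0), neg_sub]
          exact mul_le_of_le_one_left (by linarith) (hy i)
        · refine (Finset.abs_sum_le_sum_abs _ _).trans (Finset.sum_le_sum fun j _ => ?_)
          rw [abs_mul, abs_of_nonneg (hw j x)]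
          exact mul_le_of_le_one_left (hw j x) (hy j)
      _ ≤ 2 * ε := by linarith

theorem Polynomial.Chebyshev.abs_U_eval_one_sub_two_mul_sq_mul_le (n : ℕ) {v : ℝ}
    (hv0 : 0 ≤ v) (hv : v ≤ 1 / 2) :
    |(Chebyshev.U ℝ n).eval (1 - 2 * v ^ 2)| * v ≤ 1 := by
  have hsin : Real.sin (Real.arcsin v) = v := Real.sin_arcsin (by linarith) (by linarith)
  have h := Chebyshev.U_real_cos (2 * Real.arcsin v) n
  have hcos : 1 / 2 ≤ Real.cos (Real.arcsin v) := by
    rw [Real.cos_arcsin]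
    exact Real.le_sqrt_of_sq_le (by nlinarith)
  rw [Real.cos_two_mul, Real.cos_sq', Real.sin_two_mul, hsin] at h
  have h1 := congrArg abs h
  rw [abs_mul, abs_of_nonneg (by positivity : 0 ≤ 2 * v * Real.cos (Real.arcsin v)),
    show 2 * (1 - v ^ 2) - 1 = 1 - 2 * v ^ 2 by ring] at h1
  have h2 := h1.trans_le (Real.abs_sin_le_one _)
  refine le_trans ?_ h2
  refine mul_le_mul_of_nonneg_left ?_ (abs_nonneg _)
  nlinarith

theorem Polynomial.Chebyshev.half_le_U_eval_one_sub_two_mul_sq (n : ℕ) {v : ℝ}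
    (hv0 : 0 ≤ v) (hv : v ≤ 1 / (2 * (n + 1))) :
    ((n : ℝ) + 1) / 2 ≤ (Chebyshev.U ℝ n).eval (1 - 2 * v ^ 2) := by
  have hn : (0 : ℝ) < n + 1 := by positivity
  rcases hv0.eq_or_lt with rfl | hv0'
  · simp; linarith
  have hv' : v * (2 * (n + 1)) ≤ 1 := (le_div_iff₀ (by positivity)).1 hv
  have hv1 : v ≤ 1 / 2 := by nlinarith [(n.cast_nonneg : (0 : ℝ) ≤ n)]
  have hsin : Real.sin (Real.arcsin v) = v := Real.sin_arcsin (by linarith) (by linarith)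
  have h := Chebyshev.U_real_cos (2 * Real.arcsin v) n
  set φ := Real.arcsin v with hφ
  have hφ0 : 0 < φ := Real.arcsin_pos.2 hv0'
  have hφv : φ ≤ π / 2 * v := by
    have := Real.mul_le_sin hφ0.le (Real.arcsin_le_pi_div_two v)
    rw [hsin, div_mul_eq_mul_div, div_le_iff₀ Real.pi_pos] at this
    linarith
  have hφpi : φ < π / 2 := by nlinarith [Real.pi_pos]
  have hs0 : 0 < Real.sin (2 * φ) := Real.sin_pos_of_pos_of_lt_pi (by linarith) (by linarith)
  have hs1 : Real.sin (2 * φ) ≤ 2 * φ := Real.sin_le (by linarith)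
  have hbig : 2 / π * ((n + 1) * (2 * φ)) ≤ Real.sin ((n + 1) * (2 * φ)) := by
    refine Real.mul_le_sin (by positivity) ?_
    nlinarith [Real.pi_pos]
  have hcos : Real.cos (2 * φ) = 1 - 2 * v ^ 2 := by
    rw [Real.cos_two_mul, Real.cos_sq', hsin]; ring
  rw [hcos] at h
  push_cast at h
  refine le_of_mul_le_mul_right ?_ hs0
  rw [h]
  refine le_trans ?_ hbig
  have h2pi : 1 / 2 ≤ 2 / π := by
    rw [div_le_div_iff₀ two_pos Real.pi_pos]; linarith [Real.pi_le_four]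
  calc ((n : ℝ) + 1) / 2 * Real.sin (2 * φ) ≤ (n + 1) / 2 * (2 * φ) := by gcongr
    _ = 1 / 2 * ((n + 1) * (2 * φ)) := by ring
    _ ≤ 2 / π * ((n + 1) * (2 * φ)) := by gcongr

/-- A power of a Chebyshev polynomial is a nonnegative kernel on `[-1/2, 1/2]` whose mass outside
`[-η, η]` is exponentially small. -/
theorem exists_concentrated_kernel (n r : ℕ) (hr : 3 ≤ r) {η : ℝ} (hη0 : 0 < η) (hη : η ≤ 1 / 2)
    (hnη : 4 ≤ (n + 1) * η) :
    ∃ K : ℝ[X], K.natDegree ≤ 4 * r * n ∧ (∀ v, 0 ≤ K.eval v) ∧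
      (0 < ∫ v in -(1 / 2)..(1 / 2), K.eval v) ∧
      (1 - (1 / 2) ^ r) * ∫ v in -(1 / 2)..(1 / 2), K.eval v ≤ ∫ v in -η..η, K.eval v := by
  obtain ⟨m, rfl⟩ : ∃ m, r = m + 1 := ⟨r - 1, by omega⟩
  set M : ℝ := (n : ℝ) + 1 with hM
  have hM0 : 0 < M := by positivity
  let q : ℝ[X] := (Chebyshev.U ℝ n).comp (1 - 2 * X ^ 2)
  let K : ℝ[X] := q ^ (2 * (m + 1))
  have hq : ∀ v, q.eval v = (Chebyshev.U ℝ n).eval (1 - 2 * v ^ 2) := fun v => by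
    simp [q, eval_comp]
  have hK : ∀ v, K.eval v = |q.eval v| ^ (2 * (m + 1)) := fun v => by
    simp only [K, eval_pow]; rw [Even.pow_abs ⟨m + 1, by ring⟩]
  have hKnn : ∀ v, 0 ≤ K.eval v := fun v => by rw [hK]; positivity
  have hint : ∀ u v : ℝ, IntervalIntegrable (fun x => K.eval x) MeasureTheory.volume u v :=
    fun u v => K.continuous.intervalIntegrable u v
  have hsymm : ∀ u : ℝ, ∫ v in -u..u, K.eval v = 2 * ∫ v in (0 : ℝ)..u, K.eval v := by
    intro u
    have h := intervalIntegral.integral_comp_neg (a := 0) (b := u) (fun v => K.eval v)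
    have he : ∀ v, K.eval (-v) = K.eval v := fun v => by rw [hK, hK, hq, hq, neg_sq]
    simp only [he, neg_zero] at h
    rw [← intervalIntegral.integral_add_adjacent_intervals (hint (-u) 0) (hint 0 u), ← h]
    ring
  have hMη : 1 / (2 * M) ≤ η := by
    rw [div_le_iff₀ (by positivity)]; linarith
  have hlow : 1 / (2 * M) * (M / 2) ^ (2 * (m + 1)) ≤ ∫ v in (0 : ℝ)..(1 / 2), K.eval v := by
    calc 1 / (2 * M) * (M / 2) ^ (2 * (m + 1))
        = ∫ _ in (0 : ℝ)..(1 / (2 * M)), (M / 2) ^ (2 * (m + 1)) := by simp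
      _ ≤ ∫ v in (0 : ℝ)..(1 / (2 * M)), K.eval v := by
        refine intervalIntegral.integral_mono_on (by positivity)
          (continuous_const.intervalIntegrable _ _) (hint _ _) fun v hv => ?_
        rw [hK, hq]
        gcongr
        exact (Chebyshev.half_le_U_eval_one_sub_two_mul_sq n hv.1 hv.2).trans (le_abs_self _)
      _ ≤ ∫ v in (0 : ℝ)..(1 / 2), K.eval v :=
        intervalIntegral.integral_mono_interval le_rfl (by positivity) (hMη.trans hη)
          (Filter.Eventually.of_forall fun v => hKnn v) (hint _ _)
  have htail : ∫ v in η..(1 / 2), K.eval v ≤ (1 / η) ^ (2 * m) * (1 / η) := by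
    have h0 : (0 : ℝ) ∉ Set.uIcc η (1 / 2) := by
      rw [Set.uIcc_of_le hη]; exact fun h => hη0.not_ge h.1
    calc ∫ v in η..(1 / 2), K.eval v
        ≤ ∫ v in η..(1 / 2), (1 / η) ^ (2 * m) * v ^ (-2 : ℤ) := by
          refine intervalIntegral.integral_mono_on hη (hint _ _)
            ((intervalIntegral.intervalIntegrable_zpow (Or.inr h0)).const_mul _) fun v hv => ?_
          have hv0 : 0 < v := hη0.trans_le hv.1
          have hqv : |q.eval v| ≤ 1 / v := by
            rw [le_div_iff₀ hv0, hq]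
            exact Chebyshev.abs_U_eval_one_sub_two_mul_sq_mul_le n hv0.le hv.2
          have hv2 : v ^ (-2 : ℤ) = (1 / v) ^ 2 := by
            rw [one_div, inv_pow, zpow_neg]; norm_cast
          rw [hK, hv2, mul_add, pow_add]
          gcongr
          exact hqv.trans (one_div_le_one_div_of_le hη0 hv.1)
      _ = (1 / η) ^ (2 * m) * (1 / η - 2) := by
          rw [intervalIntegral.integral_const_mul, integral_zpow (Or.inr ⟨by norm_num, h0⟩)]
          norm_num [zpow_neg]
          left
          ring
      _ ≤ (1 / η) ^ (2 * m) * (1 / η) := by gcongr; linarith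
  have hpos : 0 < ∫ v in (0 : ℝ)..(1 / 2), K.eval v := lt_of_lt_of_le (by positivity) hlow
  have hcomp : (1 / η) ^ (2 * m) * (1 / η) ≤
      (1 / 2) ^ (m + 1) * (1 / (2 * M) * (M / 2) ^ (2 * (m + 1))) := by
    obtain ⟨k, rfl⟩ : ∃ k, m = k + 2 := ⟨m - 2, by omega⟩
    set z := M * η / 2 with hz
    have hz2 : 2 ≤ z := by linarith
    have hMz : M / 2 = z * (1 / η) := by rw [hz]; field_simp
    have hM1 : 1 / (2 * M) = 1 / (4 * z) * η := by rw [hz]; field_simp; norm_num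
    rw [hM1, hMz, mul_pow]
    have hzpow : (2 : ℝ) ^ (k + 3) * 4 ≤ z ^ (2 * k + 5) := by
      calc (2 : ℝ) ^ (k + 3) * 4 = 2 ^ (k + 5) := by ring
        _ ≤ 2 ^ (2 * k + 5) := pow_le_pow_right₀ (by norm_num) (by omega)
        _ ≤ z ^ (2 * k + 5) := by gcongr
    have hz0 : 0 < z := by linarith
    have key : (1 : ℝ) ≤ (1 / 2) ^ (k + 3) * (1 / 4) * z ^ (2 * k + 5) := by
      calc (1 : ℝ) = (1 / 2) ^ (k + 3) * (1 / 4) * (2 ^ (k + 3) * 4) := by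
            rw [one_div_pow]; field_simp
        _ ≤ (1 / 2) ^ (k + 3) * (1 / 4) * z ^ (2 * k + 5) := by gcongr
    calc (1 / η) ^ (2 * (k + 2)) * (1 / η) = (1 / η) ^ (2 * k + 5) := by ring
      _ ≤ ((1 / 2) ^ (k + 3) * (1 / 4) * z ^ (2 * k + 5)) * (1 / η) ^ (2 * k + 5) :=
        le_mul_of_one_le_left (by positivity) key
      _ = _ := by
        have e1 : 2 * (k + 2 + 1) = (2 * k + 5) + 1 := by ring
        rw [e1, pow_succ z (2 * k + 5), pow_succ (1 / η) (2 * k + 5)]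
        generalize z ^ (2 * k + 5) = Z
        generalize (1 / η) ^ (2 * k + 5) = W
        field_simp
  refine ⟨K, ?_, hKnn, ?_, ?_⟩
  · refine natDegree_pow_le.trans ?_
    have h1 : (1 - 2 * X ^ 2 : ℝ[X]).natDegree ≤ 2 := by compute_degree
    have h2 : q.natDegree ≤ n * 2 :=
      natDegree_comp_le.trans (by rw [Chebyshev.natDegree_U_natCast]; gcongr)
    calc 2 * (m + 1) * q.natDegree ≤ 2 * (m + 1) * (n * 2) := by gcongr
      _ = 4 * (m + 1) * n := by ring
  · rw [hsymm]; linarith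
  · rw [hsymm, hsymm]
    have hsplit := intervalIntegral.integral_add_adjacent_intervals (hint 0 η) (hint η (1 / 2))
    have hmul := mul_le_mul_of_nonneg_left hlow
      (by positivity : (0 : ℝ) ≤ (1 / 2) ^ (m + 1))
    linarith

/-- The kernel of `exists_concentrated_kernel` rescaled to an arbitrary symmetric interval. -/
theorem exists_concentrated_kernel_scaled (n r : ℕ) (hr : 3 ≤ r) {δ L : ℝ} (hδ : 0 < δ)
    (hL : 0 < L) (hδL : δ ≤ L / 2) (hn : 4 * L ≤ (n + 1) * δ) :
    ∃ K : ℝ[X], K.natDegree ≤ 4 * r * n ∧ (∀ v, 0 ≤ K.eval v) ∧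
      (0 < ∫ v in -(L / 2)..(L / 2), K.eval v) ∧
      (1 - (1 / 2) ^ r) * ∫ v in -(L / 2)..(L / 2), K.eval v ≤ ∫ v in -δ..δ, K.eval v := by
  obtain ⟨K, hdeg, hnn, hpos, htail⟩ := exists_concentrated_kernel n r hr (η := δ / L)
    (by positivity) (by rw [div_le_iff₀ hL]; linarith)
    (by rw [mul_div_assoc', le_div_iff₀ hL]; exact hn)
  have heval : ∀ v, (K.comp (Polynomial.C L⁻¹ * X)).eval v = K.eval (v / L) := fun v => by
    simp [eval_comp, div_eq_inv_mul]
  have hI : ∀ u, ∫ v in -u..u, (K.comp (Polynomial.C L⁻¹ * X)).eval v =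
      L * ∫ v in -(u / L)..(u / L), K.eval v := fun u => by
    simp only [heval]
    rw [intervalIntegral.integral_comp_div (fun v => K.eval v) hL.ne', smul_eq_mul, neg_div]
  have hhalf : L / 2 / L = 1 / 2 := by field_simp
  refine ⟨K.comp (Polynomial.C L⁻¹ * X), ?_, fun v => heval v ▸ hnn _, ?_, ?_⟩
  · rw [natDegree_comp, natDegree_C_mul_X _ (by positivity), mul_one]
    exact hdeg
  · rw [hI, hhalf]; positivity
  · rw [hI, hI, hhalf, mul_left_comm]
    exact mul_le_mul_of_nonneg_left htail hL.le

theorem general_bound_Enstar :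
    ∃ c : ℝ, 0 < c ∧
      ∀ (s : ℕ) (a b : Fin s → ℝ) (σ D : ℝ),
        (∀ i, a i ≤ b i) →
        (Pairwise fun i j => Disjoint (Set.Icc (a i) (b i)) (Set.Icc (a j) (b j))) →
        0 < σ →
        (∀ i j : Fin s, i ≠ j → ∀ x ∈ Set.Icc (a i) (b i), ∀ t ∈ Set.Icc (a j) (b j),
          σ ≤ |x - t|) →
        0 < D →
        (∀ x ∈ ⋃ i, Set.Icc (a i) (b i), ∀ t ∈ ⋃ i, Set.Icc (a i) (b i), |x - t| ≤ D) →
        ∀ (y : Fin s → ℝ), (∀ i, y i ∈ Set.Icc (-1 : ℝ) 1) →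
        ∀ n : ℕ,
          ∃ P : Polynomial ℝ, P.natDegree ≤ n ∧
            (∀ t ∈ convexHull ℝ (⋃ i, Set.Icc (a i) (b i)), |P.eval t| ≤ 1) ∧
            (∀ i, ∀ t ∈ Set.Icc (a i) (b i),
              |P.eval t - y i| ≤ 2 * Real.exp (-c * n * σ / D)) := by
  refine ⟨1 / 1000, by norm_num, fun s a b σ D hab hdisj hσ hgap hD hdiam y hy n => ?_⟩
  have hy' : ∀ i, |y i| ≤ 1 := fun i => abs_le.2 (hy i)
  set E := Real.exp (-(1 / 1000) * n * σ / D) with hE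
  rcases subsingleton_or_nontrivial (Fin s) with hs | hs
  · rcases isEmpty_or_nonempty (Fin s) with he | ⟨⟨i₀⟩⟩
    · exact ⟨0, by simp, by simp, fun i => he.elim i⟩
    · refine ⟨Polynomial.C (y i₀), by simp, fun t _ => by simpa using hy' i₀, fun i t _ => ?_⟩
      rw [Subsingleton.elim i i₀]
      simp only [eval_C, sub_self, abs_zero]
      positivity
  have ha : ∀ i, a i ∈ ⋃ i, Icc (a i) (b i) := fun i => mem_iUnion.2 ⟨i, left_mem_Icc.2 (hab i)⟩
  have hb : ∀ i, b i ∈ ⋃ i, Icc (a i) (b i) := fun i => mem_iUnion.2 ⟨i, right_mem_Icc.2 (hab i)⟩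
  have hσD : σ ≤ D := by
    obtain ⟨i, j, hij⟩ := exists_pair_ne (Fin s)
    exact (hgap i j hij _ (left_mem_Icc.2 (hab i)) _ (left_mem_Icc.2 (hab j))).trans
      (hdiam _ (ha i) _ (ha j))
  set ρ := n * σ / D with hρ
  have hEρ : E = Real.exp (-(ρ / 1000)) := by rw [hE, hρ]; congr 1; ring
  have hρ0 : 0 ≤ ρ := by positivity
  set r := ⌊ρ / 100⌋₊ with hr
  have hr1 : (r : ℝ) ≤ ρ / 100 := Nat.floor_le (by positivity)
  have hr2 : ρ / 100 < r + 1 := Nat.lt_floor_add_one _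
  rcases lt_or_ge r 3 with hr3 | hr3
  · refine ⟨0, by simp, by simp, fun i t _ => ?_⟩
    have hr3' : (r : ℝ) ≤ 2 := by exact_mod_cast Nat.le_of_lt_succ hr3
    simp only [eval_zero, zero_sub, abs_neg]
    have := Real.add_one_le_exp (-(ρ / 1000))
    rw [hEρ]
    linarith [hy' i]
  set m := ⌊24 * D / σ⌋₊ with hm
  have hm1 : (m : ℝ) ≤ 24 * D / σ := Nat.floor_le (by positivity)
  have hm2 : 24 * D / σ < m + 1 := Nat.lt_floor_add_one _
  obtain ⟨K, hKdeg, hKnn, hKpos, hKtail⟩ := exists_concentrated_kernel_scaled m r hr3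
    (δ := σ / 2) (L := 3 * D) (by positivity) (by positivity) (by linarith)
    (by rw [div_lt_iff₀ hσ] at hm2; linarith)
  obtain ⟨P, hPdeg, hPb, hPy⟩ := exists_polynomial_of_kernel K hKnn (by positivity) hKpos hKtail
    (S := convexHull ℝ (⋃ i, Icc (a i) (b i))) hab
    (fun i j hij => by
      have h1 := hgap i j hij (b i) (right_mem_Icc.2 (hab i)) (a j) (left_mem_Icc.2 (hab j))
      have h2 := hgap i j hij (a i) (left_mem_Icc.2 (hab i)) (b j) (right_mem_Icc.2 (hab j))
      by_cases h : b i < a j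
      · left; rw [abs_of_neg (by linarith)] at h1; linarith
      by_cases h' : b j < a i
      · right; rw [abs_of_pos (by linarith)] at h2; linarith
      · push Not at h h'
        exact (Set.disjoint_left.1 (hdisj hij)
          (⟨le_max_left _ _, max_le (hab i) h⟩ : max (a i) (a j) ∈ Icc (a i) (b i))
          ⟨le_max_right _ _, max_le h' (hab j)⟩).elim)
    (fun x hx i => by
      have hball : ∀ t ∈ ⋃ i, Icc (a i) (b i), |x - t| ≤ D := fun t ht =>
        convexHull_min (fun z hz => Metric.mem_closedBall.2 (hdiam z hz t ht))
          (convex_closedBall t D) hx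
      have h1 := abs_le.1 (hball _ (ha i))
      have h2 := abs_le.1 (hball _ (hb i))
      constructor <;> linarith) hy'
  refine ⟨P, hPdeg.trans ?_, hPb, fun i t ht => ?_⟩
  · have hrR : (3 : ℝ) ≤ r := by exact_mod_cast hr3
    have hDσ : 1 ≤ D / σ := (one_le_div hσ).2 hσD
    have hn : (n : ℝ) = ρ * (D / σ) := by rw [hρ]; field_simp
    have : ((K.natDegree + 1 : ℕ) : ℝ) ≤ n := by
      have hK' : (K.natDegree : ℝ) ≤ 4 * r * m := by exact_mod_cast hKdeg
      push_cast
      rw [hn]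
      have h1 : (r : ℝ) * m ≤ r * (24 * (D / σ)) := by
        rw [← mul_div_assoc]; gcongr
      have h2 : 100 * r * (D / σ) ≤ ρ * (D / σ) := by gcongr; linarith
      nlinarith
    exact_mod_cast this
  · refine (hPy i t ht (subset_convexHull ℝ _ (mem_iUnion.2 ⟨i, ht⟩))).trans ?_
    gcongr
    have hrR : (3 : ℝ) ≤ r := by exact_mod_cast hr3
    have hhalf : (1 / 2 : ℝ) ≤ Real.exp (-(1 / 2)) := by
      linarith [Real.add_one_le_exp (-(1 / 2) : ℝ)]
    calc (1 / 2 : ℝ) ^ r ≤ Real.exp (-(1 / 2)) ^ r := by gcongr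
      _ = Real.exp (r * -(1 / 2)) := (Real.exp_nat_mul _ _).symm
      _ ≤ E := by
        rw [hEρ]
        exact Real.exp_le_exp.2 (by linarith)
end

section
/- Jackson–Favard inequality: for any absolutely continuous function f on [−1,1] with |f′| ≤ L almost everywhere, and any n ∈ ℕ, there exists a polynomial P of degree ≤ n with sup_{t∈[−1,1]} |f(t) − P(t)| ≤ πL/(2(n+1)). -/
open Polynomial Real

/-- The error of approximating the sawtooth function `t ↦ (π - t) / 2` by the sine polynomial with
coefficients `a 0, …, a (n - 1)`. -/
noncomputable def sawtoothError (n : ℕ) (a : ℕ → ℝ) (t : ℝ) : ℝ :=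
  (π - t) / 2 - ∑ j ∈ Finset.range n, a j * sin ((j + 1) * t)

/-- The derivative of `sawtoothError`. -/
noncomputable def sawtoothErrorDeriv (n : ℕ) (a : ℕ → ℝ) (t : ℝ) : ℝ :=
  -1 / 2 - ∑ j ∈ Finset.range n, a j * (j + 1) * cos ((j + 1) * t)

theorem hasDerivAt_sawtoothError (n : ℕ) (a : ℕ → ℝ) (t : ℝ) :
    HasDerivAt (sawtoothError n a) (sawtoothErrorDeriv n a t) t := by
  unfold sawtoothError sawtoothErrorDeriv
  refine HasDerivAt.sub ?_ (HasDerivAt.fun_sum fun j _ => ?_)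
  · exact ((hasDerivAt_id t).const_sub π).div_const 2
  · have h := (((hasDerivAt_id t).const_mul ((j : ℝ) + 1)).sin).const_mul (a j)
    refine h.congr_deriv ?_
    simp only [id]
    ring

theorem continuous_sawtoothError (n : ℕ) (a : ℕ → ℝ) : Continuous (sawtoothError n a) := by
  unfold sawtoothError
  fun_prop

theorem continuous_sawtoothErrorDeriv (n : ℕ) (a : ℕ → ℝ) :
    Continuous (sawtoothErrorDeriv n a) := by
  unfold sawtoothErrorDeriv
  fun_prop

theorem sawtoothError_zero (n : ℕ) (a : ℕ → ℝ) : sawtoothError n a 0 = π / 2 := by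
  simp [sawtoothError]

theorem sawtoothError_pi (n : ℕ) (a : ℕ → ℝ) : sawtoothError n a π = 0 := by
  have h (j : ℕ) : sin (((j : ℝ) + 1) * π) = 0 := mod_cast sin_nat_mul_pi (j + 1)
  simp [sawtoothError, h]

/-- The Chebyshev polynomials of the second kind, as a polynomial sequence. -/
noncomputable def chebyshevUSequence : Polynomial.Sequence ℝ where
  elems' n := Chebyshev.U ℝ n
  degree_eq' n := by simp

theorem exists_sum_chebyshev_U {n : ℕ} {q : ℝ[X]} (hq : q.degree < n) :
    ∃ a : ℕ → ℝ, q = ∑ j ∈ Finset.range n, a j • Chebyshev.U ℝ j := by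
  have hspan := chebyshevUSequence.span_degreeLT (m := n) fun i _ => by
    simp [(chebyshevUSequence.ne_zero i)]
  have hmem : q ∈ Submodule.span ℝ (chebyshevUSequence '' (Finset.range n : Set ℕ)) := by
    rw [Finset.coe_range, hspan]
    exact mem_degreeLT.2 hq
  rw [Submodule.mem_span_image_finset_iff_exists_fun] at hmem
  obtain ⟨a, ha⟩ := hmem
  refine ⟨fun j => if hj : j ∈ Finset.range n then a ⟨j, hj⟩ else 0, ?_⟩
  rw [← ha, ← Finset.sum_coe_sort (Finset.range n)]
  exact Finset.sum_congr rfl fun j _ => by simp only [dif_pos j.2]; rfl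

theorem exists_sawtoothError_eq_zero (n : ℕ) :
    ∃ a : ℕ → ℝ, ∀ k : ℕ, k < n → sawtoothError n a ((k + 1) * π / (n + 1)) = 0 := by
  have hN : (0 : ℝ) < n + 1 := by positivity
  set x : ℕ → ℝ := fun k => (k + 1) * π / (n + 1) with hx
  have hxI {k : ℕ} (hk : k < n) : 0 < x k ∧ x k < π := by
    have hk' : (k : ℝ) + 1 < n + 1 := by exact_mod_cast Nat.succ_lt_succ hk
    refine ⟨by positivity, ?_⟩
    simp only [hx]
    rw [div_lt_iff₀ hN]
    nlinarith [pi_pos]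
  have hinj : Set.InjOn (fun k => cos (x k)) (Finset.range n) := by
    intro k hk l hl h
    simp only [Finset.coe_range, Set.mem_Iio] at hk hl
    have h' := injOn_cos ⟨(hxI hk).1.le, (hxI hk).2.le⟩ ⟨(hxI hl).1.le, (hxI hl).2.le⟩ h
    simp only [hx] at h'
    field_simp at h'
    exact_mod_cast add_right_cancel h'
  set q := Lagrange.interpolate (Finset.range n) (fun k => cos (x k))
    fun k => (π - x k) / 2 / sin (x k)
  obtain ⟨a, ha⟩ := exists_sum_chebyshev_U (n := n) (q := q)
    ((Lagrange.degree_interpolate_lt _ hinj).trans_eq (by rw [Finset.card_range]))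
  refine ⟨a, fun k hk => ?_⟩
  have hsin : sin (x k) ≠ 0 := (sin_pos_of_pos_of_lt_pi (hxI hk).1 (hxI hk).2).ne'
  have hq : q.eval (cos (x k)) = (π - x k) / 2 / sin (x k) :=
    Lagrange.eval_interpolate_at_node _ hinj (Finset.mem_range.2 hk)
  rw [eq_div_iff hsin, ha, eval_finsetSum, Finset.sum_mul] at hq
  have hU (j : ℕ) : (Chebyshev.U ℝ j).eval (cos (x k)) * sin (x k) = sin ((j + 1) * x k) := by
    rw [Chebyshev.U_real_cos]; norm_cast
  simp only [eval_smul, smul_eq_mul, mul_assoc, hU] at hq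
  change sawtoothError n a (x k) = 0
  rw [sawtoothError, hq, sub_self]

/-- Rolle's theorem, counting zeros: between `m + 1` zeros lie `m` zeros of the derivative. -/
theorem exists_strictMono_hasDerivAt_eq_zero {F F' : ℝ → ℝ} (hF : ∀ t, HasDerivAt F (F' t) t)
    {m : ℕ} {z : Fin (m + 1) → ℝ} (hz : StrictMono z) (hFz : ∀ i, F (z i) = 0) :
    ∃ r : Fin m → ℝ, StrictMono r ∧ ∀ i, F' (r i) = 0 ∧ r i ∈ Set.Ioo (z i.castSucc) (z i.succ) := by
  have h (i : Fin m) : ∃ c ∈ Set.Ioo (z i.castSucc) (z i.succ), F' c = 0 :=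
    exists_hasDerivAt_eq_zero (hz i.castSucc_lt_succ)
      (fun t _ => (hF t).continuousAt.continuousWithinAt) (by rw [hFz, hFz]) fun t _ => hF t
  choose r hr hr0 using h
  refine ⟨r, fun i j hij => ?_, fun i => ⟨hr0 i, hr i⟩⟩
  exact (hr i).2.trans_le ((hz.monotone (Fin.succ_le_castSucc_iff.2 hij)).trans (hr j).1.le)

theorem eq_C_coeff_mul_prod_X_sub_C {m : ℕ} {S : ℝ[X]} (hS : S.natDegree ≤ m) {r : Fin m → ℝ}
    (hr : Function.Injective r) (hroot : ∀ i, S.eval (r i) = 0) :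
    S = C (S.coeff m) * ∏ i, (X - C (r i)) := by
  have hmonic : (∏ i, (X - C (r i))).Monic := monic_prod_X_sub_C r Finset.univ
  have hdeg : (∏ i, (X - C (r i))).natDegree = m := by simp
  rw [← sub_eq_zero]
  refine eq_zero_of_degree_lt_of_eval_index_eq_zero Finset.univ hr.injOn ?_ ?_
  · rw [Finset.card_univ, Fintype.card_fin, degree_lt_iff_coeff_zero]
    intro k hk
    rcases hk.eq_or_lt with rfl | hk
    · have := hmonic.coeff_natDegree
      rw [hdeg] at this
      simp [this]
    · rw [coeff_sub, coeff_C_mul, coeff_eq_zero_of_natDegree_lt (hS.trans_lt hk),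
        coeff_eq_zero_of_natDegree_lt (hdeg.trans_lt hk)]
      simp
  · intro i _
    simp [hroot, eval_prod, Finset.prod_eq_zero (Finset.mem_univ i)]

theorem sawtoothError_mul_sin_nonneg {n : ℕ} {a : ℕ → ℝ}
    (ha : ∀ k : ℕ, k < n → sawtoothError n a ((k + 1) * π / (n + 1)) = 0) {t : ℝ}
    (ht : t ∈ Set.Ioo 0 π) : 0 ≤ sawtoothError n a t * sin ((n + 1) * t) := by
  have hN : (0 : ℝ) < n + 1 := by positivity
  by_contra! hneg
  have hs : sin ((n + 1) * t) ≠ 0 := fun h => by simp [h] at hneg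
  set c := sawtoothError n a t / sin ((n + 1) * t) with hc
  have hc0 : c ≤ 0 := by
    rw [hc, ← mul_div_mul_right _ _ hs]
    exact div_nonpos_of_nonpos_of_nonneg hneg.le (mul_self_nonneg _)
  set F : ℝ → ℝ := fun s => sawtoothError n a s - c * sin ((n + 1) * s) with hFdef
  set S : ℝ[X] := C (-1 / 2) - ∑ j ∈ Finset.range n, C (a j * (j + 1)) * Chebyshev.T ℝ (j + 1 : ℕ)
    - C (c * (n + 1)) * Chebyshev.T ℝ (n + 1 : ℕ) with hSdef
  have hF (s : ℝ) : HasDerivAt F (S.eval (cos s)) s := by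
    have h := (hasDerivAt_sawtoothError n a s).sub
      ((((hasDerivAt_id s).const_mul ((n : ℝ) + 1)).sin).const_mul c)
    refine h.congr_deriv ?_
    simp only [hSdef, sawtoothErrorDeriv, eval_sub, eval_C, eval_finsetSum, eval_mul,
      Chebyshev.T_real_cos]
    push_cast
    simp only [id]
    ring
  have hlow : (C (-1 / 2) - ∑ j ∈ Finset.range n,
      C (a j * (j + 1)) * Chebyshev.T ℝ (j + 1 : ℕ)).natDegree ≤ n := by
    refine (natDegree_sub_le_of_le (n := n) ((natDegree_C _).trans_le n.zero_le)
      (natDegree_sum_le_of_forall_le _ _ fun j hj => ?_)).trans (max_self n).le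
    refine (natDegree_C_mul_le _ _).trans ?_
    rw [Chebyshev.natDegree_T, Int.natAbs_natCast]
    exact Finset.mem_range.1 hj
  have hSdeg : S.natDegree ≤ n + 1 := by
    refine (natDegree_sub_le_of_le (n := n + 1) (hlow.trans n.le_succ)
      ((natDegree_C_mul_le _ _).trans ?_)).trans (max_self _).le
    rw [Chebyshev.natDegree_T, Int.natAbs_natCast]
  have hScoeff : 0 ≤ S.coeff (n + 1) := by
    have hT : (Chebyshev.T ℝ (n + 1 : ℕ)).coeff (n + 1) = 2 ^ n := by
      have := Chebyshev.leadingCoeff_T ℝ (n + 1 : ℕ)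
      rwa [leadingCoeff, Chebyshev.natDegree_T, Int.natAbs_natCast, Nat.add_sub_cancel] at this
    rw [hSdef, coeff_sub, coeff_eq_zero_of_natDegree_lt (Nat.lt_succ_of_le hlow), coeff_C_mul, hT]
    have := mul_nonneg (mul_nonneg (neg_nonneg.2 hc0) hN.le) (pow_nonneg zero_le_two n)
    linarith
  set node : ℕ → ℝ := fun k => (k + 1) * π / (n + 1) with hnode
  have hsin_node (k : ℕ) : sin ((n + 1) * node k) = 0 := by
    have : (n + 1) * node k = (k + 1 : ℕ) * π := by
      simp only [hnode]; push_cast; field_simp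
    rw [this, sin_nat_mul_pi]
  have hnode_last : node n = π := by simp only [hnode]; field_simp
  have hnode_mono : StrictMono node := fun k l hkl => by
    have : (k : ℝ) < l := by exact_mod_cast hkl
    simp only [hnode]
    gcongr
  have hFnode (k : ℕ) (hk : k ≤ n) : F (node k) = 0 := by
    rcases hk.eq_or_lt with rfl | hk
    · simp only [hFdef, hsin_node]
      rw [hnode_last, sawtoothError_pi]; simp
    · simp only [hFdef, hsin_node]
      rw [ha k hk]; simp
  have hFt : F t = 0 := by simp only [hFdef, hc]; field_simp; ring
  have ht_notMem : t ∉ (Finset.range (n + 1)).image node := by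
    rw [Finset.mem_image]
    rintro ⟨k, _, rfl⟩
    exact hs (hsin_node k)
  set Z : Finset ℝ := insert t ((Finset.range (n + 1)).image node)
  have hZcard : Z.card = n + 1 + 1 := by
    rw [Finset.card_insert_of_notMem ht_notMem,
      Finset.card_image_of_injective _ hnode_mono.injective, Finset.card_range]
  have hZ {s : ℝ} (hs : s ∈ Z) : F s = 0 ∧ 0 < s ∧ s ≤ π := by
    rcases Finset.mem_insert.1 hs with rfl | hs
    · exact ⟨hFt, ht.1, ht.2.le⟩
    · obtain ⟨k, hk, rfl⟩ := Finset.mem_image.1 hs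
      have hk' : k ≤ n := Nat.lt_succ_iff.1 (Finset.mem_range.1 hk)
      exact ⟨hFnode k hk', by positivity, hnode_last ▸ hnode_mono.monotone hk'⟩
  set z := Z.orderEmbOfFin hZcard
  have hzZ (i) : F (z i) = 0 ∧ 0 < z i ∧ z i ≤ π := hZ (Z.orderEmbOfFin_mem hZcard i)
  obtain ⟨r, hr_mono, hr⟩ :=
    exists_strictMono_hasDerivAt_eq_zero hF z.strictMono fun i => (hzZ i).1
  have hz0 (i) : z 0 < r i := (z.monotone (Fin.zero_le _)).trans_lt (hr i).2.1
  have hrI (i) : r i ∈ Set.Icc 0 π :=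
    ⟨((hzZ 0).2.1.trans (hz0 i)).le, (hr i).2.2.le.trans (hzZ _).2.2⟩
  obtain ⟨y, hy, hFy⟩ := exists_hasDerivAt_eq_slope F _ (hzZ 0).2.1
    (fun s _ => (hF s).continuousAt.continuousWithinAt) fun s _ => hF s
  have hF0 : F 0 = π / 2 := by simp [hFdef, sawtoothError_zero]
  have hneg' : S.eval (cos y) < 0 := by
    rw [hFy, (hzZ 0).1, hF0]
    exact div_neg_of_neg_of_pos (by linarith [pi_pos]) (by linarith [(hzZ 0).2.1])
  refine hneg'.not_ge ?_
  rw [eq_C_coeff_mul_prod_X_sub_C hSdeg (r := fun i => cos (r i))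
    (fun i j hij => hr_mono.injective (injOn_cos (hrI i) (hrI j) hij)) fun i => (hr i).1]
  rw [eval_mul, eval_C, eval_prod]
  refine mul_nonneg hScoeff (Finset.prod_nonneg fun i _ => ?_)
  simp only [eval_sub, eval_X, eval_C, sub_nonneg]
  exact cos_le_cos_of_nonneg_of_le_pi hy.1.le (hrI i).2 (hy.2.trans (hz0 i)).le

theorem cos_mul_sum_alternating_cos_sub (x : ℝ) (m : ℕ) :
    cos x * ∑ k ∈ Finset.range m, (-1) ^ k * (cos (2 * (k + 1) * x) - cos (2 * k * x)) =
      (-1) ^ m * (sin x * sin (2 * m * x)) := by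
  induction m with
  | zero => simp
  | succ m ih =>
    rw [Finset.sum_range_succ, mul_add, ih]
    push_cast
    have h : 2 * ((m : ℝ) + 1) * x = 2 * m * x + 2 * x := by ring
    rw [h, cos_add, sin_add, cos_two_mul, sin_two_mul, pow_succ]
    linear_combination (2 * (-1) ^ m * cos x * cos (2 * m * x)) * sin_sq_add_cos_sq x

theorem sum_alternating_cos_sub_eq_zero {m N : ℕ} (hmN : m < N) :
    ∑ k ∈ Finset.range N, (-1 : ℝ) ^ k *
      (cos (m * ((k + 1 : ℕ) * π / N)) - cos (m * (k * π / N))) = 0 := by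
  have hN : (0 : ℝ) < N := by exact_mod_cast m.zero_le.trans_lt hmN
  have hm : (m : ℝ) < N := by exact_mod_cast hmN
  have hc : cos (m * π / (2 * N)) ≠ 0 := by
    refine (cos_pos_of_mem_Ioo ⟨?_, ?_⟩).ne'
    · exact (by linarith [pi_pos] : -(π / 2) < 0).trans_le (by positivity)
    · rw [div_lt_div_iff₀ (by positivity) two_pos]
      nlinarith [pi_pos]
  have h := cos_mul_sum_alternating_cos_sub (m * π / (2 * N)) N
  have hsin : sin (2 * N * (m * π / (2 * N))) = 0 := by
    rw [mul_div_cancel₀ _ (by positivity), sin_nat_mul_pi]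
  rw [hsin, mul_zero, mul_zero] at h
  rw [← (mul_eq_zero.1 h).resolve_left hc]
  refine Finset.sum_congr rfl fun k _ => ?_
  push_cast
  congr 3 <;> field_simp

theorem sum_alternating_sq_sub (x d : ℝ) (m : ℕ) :
    ∑ k ∈ Finset.range m, (-1 : ℝ) ^ k * ((x - k * d) ^ 2 - (x - (k + 1 : ℕ) * d) ^ 2) =
      d * (x - (-1) ^ m * (x - m * d)) := by
  induction m with
  | zero => simp
  | succ m ih =>
    rw [Finset.sum_range_succ, ih]
    push_cast
    ring

theorem integral_sawtoothError (n : ℕ) (a : ℕ → ℝ) (u v : ℝ) :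
    ∫ t in u..v, sawtoothError n a t = ((π - u) ^ 2 - (π - v) ^ 2) / 4 +
      ∑ j ∈ Finset.range n, a j / (j + 1) * (cos ((j + 1) * v) - cos ((j + 1) * u)) := by
  have hH (t : ℝ) : HasDerivAt (fun t => -(π - t) ^ 2 / 4 +
      ∑ j ∈ Finset.range n, a j / (j + 1) * cos ((j + 1) * t)) (sawtoothError n a t) t := by
    rw [sawtoothError, sub_eq_add_neg, ← Finset.sum_neg_distrib]
    refine HasDerivAt.add ?_ (HasDerivAt.fun_sum fun j _ => ?_)
    · refine (((((hasDerivAt_id t).const_sub π).pow 2).neg).div_const 4).congr_deriv ?_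
      simp only [id]
      ring
    · have h := (((hasDerivAt_id t).const_mul ((j : ℝ) + 1)).cos).const_mul (a j / (j + 1))
      refine h.congr_deriv ?_
      simp only [id]
      field_simp
  rw [intervalIntegral.integral_eq_sub_of_hasDerivAt (fun t _ => hH t)
    ((continuous_sawtoothError n a).intervalIntegrable _ _)]
  simp only [mul_sub, Finset.sum_sub_distrib]
  ring

theorem integral_abs_sawtoothError {n : ℕ} {a : ℕ → ℝ}
    (ha : ∀ k : ℕ, k < n → sawtoothError n a ((k + 1) * π / (n + 1)) = 0) :
    ∫ t in 0..π, |sawtoothError n a t| = π ^ 2 / (4 * (n + 1)) := by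
  have hN : (0 : ℝ) < (n + 1 : ℕ) := by positivity
  set node : ℕ → ℝ := fun k => k * π / (n + 1 : ℕ) with hnode
  have hpiece {k : ℕ} (hk : k < n + 1) : ∫ t in node k..node (k + 1), |sawtoothError n a t| =
      (-1) ^ k * ∫ t in node k..node (k + 1), sawtoothError n a t := by
    rw [← intervalIntegral.integral_const_mul]
    have hle : node k ≤ node (k + 1) := by
      simp only [hnode]; gcongr; exact k.le_succ
    refine intervalIntegral.integral_congr_Ioo_of_le hle fun t ht => ?_
    obtain ⟨ht1, ht2⟩ := ht
    have ht0 : t ∈ Set.Ioo 0 π := by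
      refine ⟨lt_of_le_of_lt (by positivity) ht1, ht2.trans_le ?_⟩
      have : ((k + 1 : ℕ) : ℝ) ≤ (n + 1 : ℕ) := by exact_mod_cast hk
      simp only [hnode]
      rw [div_le_iff₀ hN, mul_comm π]
      gcongr
    have hnonneg := sawtoothError_mul_sin_nonneg ha ht0
    simp only [hnode] at ht1 ht2
    rw [div_lt_iff₀ hN] at ht1
    rw [lt_div_iff₀ hN] at ht2
    push_cast at ht1 ht2
    have hpos : 0 < sin ((n + 1) * t - k * π) :=
      sin_pos_of_pos_of_lt_pi (by linarith) (by linarith)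
    rw [sin_sub_nat_mul_pi] at hpos
    have hsq : ((-1 : ℝ) ^ k) * (-1) ^ k = 1 := by rw [← mul_pow]; simp
    have h : 0 ≤ (-1) ^ k * sawtoothError n a t := by
      refine nonneg_of_mul_nonneg_left ?_ hpos
      linear_combination hnonneg - (sawtoothError n a t * sin ((n + 1) * t)) * hsq
    change |sawtoothError n a t| = (-1) ^ k * sawtoothError n a t
    rw [← abs_of_nonneg h, abs_mul]
    simp
  have hsum := intervalIntegral.sum_integral_adjacent_intervals (a := node) (n := n + 1)
    fun k _ => ((continuous_sawtoothError n a).abs.intervalIntegrable (μ := MeasureTheory.volume)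
      (node k) (node (k + 1)))
  have h0 : node 0 = 0 := by simp [hnode]
  have h1 : node (n + 1) = π := by simp only [hnode]; field_simp
  rw [h0, h1] at hsum
  rw [← hsum, Finset.sum_congr rfl fun k hk => hpiece (Finset.mem_range.1 hk)]
  simp only [integral_sawtoothError, mul_add, Finset.mul_sum]
  rw [Finset.sum_add_distrib, Finset.sum_comm]
  have hcos : ∑ j ∈ Finset.range n, ∑ k ∈ Finset.range (n + 1), (-1) ^ k *
      (a j / (j + 1) * (cos ((j + 1) * node (k + 1)) - cos ((j + 1) * node k))) = 0 := by
    refine Finset.sum_eq_zero fun j hj => ?_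
    have h := sum_alternating_cos_sub_eq_zero (Nat.succ_lt_succ (Finset.mem_range.1 hj))
    simp only [mul_left_comm _ (a j / ((j : ℝ) + 1)), ← Finset.mul_sum]
    refine mul_eq_zero_of_right _ (Eq.trans ?_ h)
    simp only [hnode, Nat.succ_eq_add_one, Nat.cast_add, Nat.cast_one]
  rw [hcos, add_zero]
  have hsq := sum_alternating_sq_sub π (π / (n + 1 : ℕ)) (n + 1)
  rw [mul_div_cancel₀ _ hN.ne', sub_self, mul_zero, sub_zero] at hsq
  simp only [← mul_div_assoc ((-1 : ℝ) ^ _), ← Finset.sum_div]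
  simp only [hnode, mul_div_assoc _ π]
  rw [hsq]
  push_cast
  field_simp

theorem abs_integral_mul_sawtoothErrorDeriv_le {K : NNReal} {ψ : ℝ → ℝ} (hψ : LipschitzWith K ψ)
    (hψ0 : ψ 0 = 0) (n : ℕ) (a : ℕ → ℝ) :
    |∫ t in 0..π, ψ t * sawtoothErrorDeriv n a t| ≤ K * ∫ t in 0..π, |sawtoothError n a t| := by
  have hderiv : deriv (sawtoothError n a) = sawtoothErrorDeriv n a :=
    funext fun t => (hasDerivAt_sawtoothError n a t).deriv
  have hC : ContDiff ℝ 1 (sawtoothError n a) := by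
    unfold sawtoothError
    fun_prop
  have hparts := (hψ.lipschitzOnWith (s := Set.uIcc 0 π)).absolutelyContinuousOnInterval
    |>.integral_mul_deriv_eq_deriv_mul hC.contDiffOn.absolutelyContinuousOnInterval
  rw [hderiv, hψ0, sawtoothError_pi, mul_zero, zero_mul, sub_zero, zero_sub] at hparts
  rw [hparts, abs_neg, ← intervalIntegral.integral_const_mul, ← Real.norm_eq_abs]
  refine intervalIntegral.norm_integral_le_of_norm_le pi_pos.le (.of_forall fun t _ => ?_)
    (((continuous_sawtoothError n a).abs.const_mul _).intervalIntegrable _ _)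
  rw [norm_mul, Real.norm_eq_abs (sawtoothError n a t)]
  gcongr
  exact norm_deriv_le_of_lipschitz hψ

theorem integral_sawtoothErrorDeriv (n : ℕ) (a : ℕ → ℝ) :
    ∫ t in 0..π, sawtoothErrorDeriv n a t = -(π / 2) := by
  rw [intervalIntegral.integral_eq_sub_of_hasDerivAt
    (fun t _ => hasDerivAt_sawtoothError n a t)
    ((continuous_sawtoothErrorDeriv n a).intervalIntegrable _ _),
    sawtoothError_pi, sawtoothError_zero, zero_sub]

theorem integral_translates_mul_cos {g : ℝ → ℝ} (hg : Continuous g)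
    (hper : Function.Periodic g (2 * π)) (heven : ∀ s, g (-s) = g s) (m : ℕ) (x : ℝ) :
    ∫ t in 0..π, (g (x - t) + g (x + t)) * cos (m * t) =
      cos (m * x) * ∫ s in -π..π, g s * cos (m * s) := by
  have hint {G : ℝ → ℝ} (hG : Continuous G) (u v : ℝ) :
      IntervalIntegrable G MeasureTheory.volume u v := hG.intervalIntegrable u v
  have hfold : ∫ t in 0..π, (g (x - t) + g (x + t)) * cos (m * t) =
      ∫ t in -π..π, g (x + t) * cos (m * t) := by
    rw [← intervalIntegral.integral_add_adjacent_intervals (a := -π) (b := 0)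
      (hint (by fun_prop) _ _) (hint (by fun_prop) _ _)]
    have h := intervalIntegral.integral_comp_neg (a := 0) (b := π)
      fun t => g (x + t) * cos (m * t)
    rw [neg_zero] at h
    rw [← h, ← intervalIntegral.integral_add (hint (by fun_prop) _ _) (hint (by fun_prop) _ _)]
    refine intervalIntegral.integral_congr fun t _ => ?_
    simp only [mul_neg, cos_neg, ← sub_eq_add_neg]
    ring
  have hshift : ∫ t in -π..π, g (x + t) * cos (m * t) =
      ∫ s in -π..π, g s * cos (m * (s - x)) := by
    have h := intervalIntegral.integral_comp_add_left (a := -π) (b := π)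
      (fun s => g s * cos (m * (s - x))) x
    simp only [add_sub_cancel_left] at h
    rw [h]
    have hp : Function.Periodic (fun s => g s * cos (m * (s - x))) (2 * π) := fun s => by
      simp only [hper s]
      rw [show (m : ℝ) * (s + 2 * π - x) = m * (s - x) + m * (2 * π) by ring,
        cos_add_nat_mul_two_pi]
    have := hp.intervalIntegral_add_eq (x + -π) (-π)
    rwa [show x + -π + 2 * π = x + π by ring, show -π + 2 * π = π by ring] at this
  have hodd : ∫ s in -π..π, g s * sin (m * s) = 0 := by
    have h := intervalIntegral.integral_comp_neg (a := -π) (b := π) fun s => g s * sin (m * s)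
    simp only [heven, mul_neg, sin_neg, intervalIntegral.integral_neg, neg_neg] at h
    linarith
  rw [hfold, hshift]
  have hexp (s : ℝ) : g s * cos (m * (s - x)) =
      cos (m * x) * (g s * cos (m * s)) + sin (m * x) * (g s * sin (m * s)) := by
    rw [mul_sub, cos_sub]; ring
  simp only [hexp]
  rw [intervalIntegral.integral_add (hint (by fun_prop) _ _) (hint (by fun_prop) _ _),
    intervalIntegral.integral_const_mul, intervalIntegral.integral_const_mul, hodd, mul_zero,
    add_zero]

theorem exists_polynomial_integral_sawtoothErrorDeriv {g : ℝ → ℝ} (hg : Continuous g)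
    (hper : Function.Periodic g (2 * π)) (heven : ∀ s, g (-s) = g s) (n : ℕ) (a : ℕ → ℝ) :
    ∃ P : ℝ[X], P.natDegree ≤ n ∧ ∀ x, P.eval (cos x) =
      ∫ t in 0..π, (g (x - t) + g (x + t)) * sawtoothErrorDeriv n a t := by
  set M : ℕ → ℝ := fun m => ∫ s in -π..π, g s * cos (m * s)
  refine ⟨C (-1 / 2 * M 0) - ∑ j ∈ Finset.range n,
    C (a j * (j + 1) * M (j + 1)) * Chebyshev.T ℝ (j + 1 : ℕ), ?_, fun x => ?_⟩
  · refine (natDegree_sub_le_of_le (n := n) ((natDegree_C _).trans_le n.zero_le)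
      (natDegree_sum_le_of_forall_le _ _ fun j hj => ?_)).trans (max_self n).le
    refine (natDegree_C_mul_le _ _).trans ?_
    rw [Chebyshev.natDegree_T, Int.natAbs_natCast]
    exact Finset.mem_range.1 hj
  · have hM (m : ℕ) := integral_translates_mul_cos hg hper heven m x
    have hexp (t : ℝ) : (g (x - t) + g (x + t)) * sawtoothErrorDeriv n a t =
        -1 / 2 * ((g (x - t) + g (x + t)) * cos ((0 : ℕ) * t)) - ∑ j ∈ Finset.range n,
          a j * (j + 1) * ((g (x - t) + g (x + t)) * cos ((j + 1 : ℕ) * t)) := by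
      rw [sawtoothErrorDeriv, mul_sub, Finset.mul_sum]
      congr 1
      · simp [mul_comm]
      · refine Finset.sum_congr rfl fun j _ => ?_
        push_cast
        ring
    simp only [hexp]
    rw [intervalIntegral.integral_sub (Continuous.intervalIntegrable (by fun_prop) _ _)
        (Continuous.intervalIntegrable (by fun_prop) _ _),
      intervalIntegral.integral_finsetSum
        fun j _ => Continuous.intervalIntegrable (by fun_prop) _ _]
    simp only [intervalIntegral.integral_const_mul, hM, eval_sub, eval_C, eval_finsetSum,
      eval_mul, Chebyshev.T_real_cos]
    congr 1
    · simp [M]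
    · refine Finset.sum_congr rfl fun j _ => ?_
      simp only [M, Int.cast_natCast]
      ring

/-- Jackson–Favard inequality for Lipschitz functions on `[-1,1]`. -/
theorem jackson_favard (f : ℝ → ℝ) (L : ℝ) (hL : 0 ≤ L)
    (hf : LipschitzOnWith (Real.toNNReal L) f (Set.Icc (-1 : ℝ) 1)) (n : ℕ) :
    ∃ P : Polynomial ℝ, P.natDegree ≤ n ∧
      ∀ t ∈ Set.Icc (-1 : ℝ) 1, |f t - P.eval t| ≤ Real.pi * L / (2 * (n + 1)) := by
  obtain ⟨a, ha⟩ := exists_sawtoothError_eq_zero n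
  set g : ℝ → ℝ := fun s => f (cos s) with hgdef
  have hg : LipschitzWith L.toNNReal g := by
    have := hf.comp (lipschitzWith_cos.lipschitzOnWith (s := Set.univ))
      fun s _ => cos_mem_Icc s
    rwa [mul_one, lipschitzOnWith_univ] at this
  have hgc := hg.continuous
  obtain ⟨Q, hQdeg, hQ⟩ := exists_polynomial_integral_sawtoothErrorDeriv hgc
    (fun s => by simp only [hgdef, cos_add_two_pi]) (fun s => by simp only [hgdef, cos_neg]) n a
  refine ⟨C (-π⁻¹) * Q, (natDegree_C_mul_le _ _).trans hQdeg, fun t ht => ?_⟩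
  set x := arccos t
  have hx : cos x = t := cos_arccos ht.1 ht.2
  set ψ : ℝ → ℝ := fun s => 2 * g x - (g (x - s) + g (x + s)) with hψdef
  have hψ : LipschitzWith (2 * L.toNNReal) ψ := by
    refine LipschitzWith.of_dist_le_mul fun s r => ?_
    have h1 := hg.dist_le_mul (x - s) (x - r)
    have h2 := hg.dist_le_mul (x + s) (x + r)
    rw [dist_sub_left] at h1
    rw [dist_add_left] at h2
    have h3 : dist (ψ s) (ψ r) ≤ dist (g (x - s)) (g (x - r)) + dist (g (x + s)) (g (x + r)) := by
      rw [hψdef, dist_sub_left]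
      exact dist_add_add_le _ _ _ _
    push_cast
    linarith
  have hbound := abs_integral_mul_sawtoothErrorDeriv_le hψ
    (by simp only [hψdef, sub_zero, add_zero]; ring) n a
  have hsc := continuous_sawtoothErrorDeriv n a
  have hint : ∫ s in 0..π, ψ s * sawtoothErrorDeriv n a s = -π * (f t - (C (-π⁻¹) * Q).eval t) := by
    simp only [hψdef, sub_mul _ _ (sawtoothErrorDeriv n a _)]
    rw [intervalIntegral.integral_sub (Continuous.intervalIntegrable (by fun_prop) _ _)
      (Continuous.intervalIntegrable (by fun_prop) _ _), intervalIntegral.integral_const_mul,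
      integral_sawtoothErrorDeriv, ← hQ, hx, eval_mul, eval_C, show g x = f t from congrArg f hx]
    field_simp
    ring
  rw [hint, integral_abs_sawtoothError ha, abs_mul, abs_neg, abs_of_pos pi_pos] at hbound
  refine le_of_mul_le_mul_left (hbound.trans_eq ?_) pi_pos
  push_cast
  rw [Real.coe_toNNReal L hL]
  field_simp
  ring
end

section
/- Let I₁,…,I_s ⊂ [−1,1] be disjoint closed intervals with minimal gap σ, and let y₁,…,y_s ∈ {−1,1}. Then there exists a polynomial P of degree at most ⌊4π/σ⌋ with ‖P‖_{C[−1,1]} ≤ 1 and |P(t) − y_i| ≤ 1/2 for all t ∈ I_i and all i. -/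
open Polynomial Real Set

/-- The squared modulus of `∑ k < m, sin (k π / m) e ^ (i k t)`. -/
noncomputable def fejerKorovkin (m : ℕ) (t : ℝ) : ℝ :=
  ∑ k ∈ Finset.range m, ∑ l ∈ Finset.range m,
    sin (k * π / m) * sin (l * π / m) * cos (((k - l : ℤ) : ℝ) * t)

theorem fejerKorovkin_nonneg (m : ℕ) (t : ℝ) : 0 ≤ fejerKorovkin m t := by
  have h : fejerKorovkin m t = (∑ k ∈ Finset.range m, sin (k * π / m) * cos (k * t)) ^ 2 +
      (∑ k ∈ Finset.range m, sin (k * π / m) * sin (k * t)) ^ 2 := by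
    rw [sq, sq, Finset.sum_mul_sum, Finset.sum_mul_sum, ← Finset.sum_add_distrib]
    refine Finset.sum_congr rfl fun k _ => ?_
    rw [← Finset.sum_add_distrib]
    refine Finset.sum_congr rfl fun l _ => ?_
    push_cast
    rw [sub_mul, cos_sub]
    ring
  rw [h]
  positivity

theorem fejerKorovkin_neg (m : ℕ) (t : ℝ) : fejerKorovkin m (-t) = fejerKorovkin m t := by
  simp only [fejerKorovkin, mul_neg, cos_neg]

theorem sum_cos_int_mul_add_equispaced {N : ℕ} {d : ℤ} (hd : |d| < N) (θ : ℝ) :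
    ∑ j ∈ Finset.range N, cos (d * (θ + 2 * π * j / N)) = if d = 0 then (N : ℝ) else 0 := by
  have hN : (0 : ℝ) < N := by
    have : (0 : ℤ) < N := (abs_nonneg d).trans_lt hd
    exact_mod_cast this
  split_ifs with h0
  · simp [h0]
  have hd' : |(d : ℝ)| < N := by exact_mod_cast hd
  have hsin : sin (π * d / N) ≠ 0 := by
    have hlt := abs_lt.1 hd'
    have h1 : -π < π * d / N := by
      rw [lt_div_iff₀ hN]; nlinarith [pi_pos]
    have h2 : π * d / N < π := by
      rw [div_lt_iff₀ hN]; nlinarith [pi_pos]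
    rw [Ne, sin_eq_zero_iff_of_lt_of_lt h1 h2]
    have : (d : ℝ) ≠ 0 := by exact_mod_cast h0
    positivity
  have htel : ∀ j : ℕ, 2 * sin (π * d / N) * cos (d * (θ + 2 * π * j / N)) =
      sin (d * θ + π * d / N * (2 * ((j + 1 : ℕ) : ℝ) - 1)) -
        sin (d * θ + π * d / N * (2 * (j : ℝ) - 1)) := by
    intro j
    have e1 : d * θ + π * d / N * (2 * ((j + 1 : ℕ) : ℝ) - 1) =
        d * (θ + 2 * π * j / N) + π * d / N := by push_cast; ring
    have e2 : d * θ + π * d / N * (2 * (j : ℝ) - 1) =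
        d * (θ + 2 * π * j / N) - π * d / N := by ring
    rw [e1, e2, sin_add, sin_sub]
    ring
  have hsum : 2 * sin (π * d / N) * ∑ j ∈ Finset.range N, cos (d * (θ + 2 * π * j / N)) = 0 := by
    rw [Finset.mul_sum, Finset.sum_congr rfl fun j _ => htel j,
      Finset.sum_range_sub fun j : ℕ => sin (d * θ + π * d / N * (2 * (j : ℝ) - 1))]
    have e : d * θ + π * d / N * (2 * (N : ℝ) - 1) =
        d * θ + π * d / N * (2 * ((0 : ℕ) : ℝ) - 1) + d * (2 * π) := by
      push_cast; field_simp; ring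
    rw [e, sin_add_int_mul_two_pi, sub_self]
  exact (mul_eq_zero.1 hsum).resolve_left (mul_ne_zero two_ne_zero hsin)

theorem sum_fejerKorovkin_equispaced (m : ℕ) (θ : ℝ) :
    ∑ j ∈ Finset.range (m + 1), fejerKorovkin m (θ + 2 * π * j / (m + 1 : ℕ)) =
      (m + 1) * ∑ k ∈ Finset.range m, sin (k * π / m) ^ 2 := by
  simp only [fejerKorovkin]
  rw [Finset.sum_comm, Finset.mul_sum]
  refine Finset.sum_congr rfl fun k hk => ?_
  rw [Finset.sum_comm]
  rw [Finset.mem_range] at hk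
  have : ∀ l ∈ Finset.range m, ∑ j ∈ Finset.range (m + 1), sin (k * π / m) * sin (l * π / m) *
      cos (((k - l : ℤ) : ℝ) * (θ + 2 * π * j / (m + 1 : ℕ))) =
      if k = l then (m + 1) * sin (k * π / m) ^ 2 else 0 := by
    intro l hl
    rw [Finset.mem_range] at hl
    rw [← Finset.mul_sum, sum_cos_int_mul_add_equispaced (by rw [abs_lt]; omega)]
    by_cases h : k = l
    · subst h; simp; ring
    · rw [if_neg (by omega), if_neg h, mul_zero]
  rw [Finset.sum_congr rfl this]
  simp [hk]

theorem sum_fejerKorovkin_mul_cos_equispaced (m : ℕ) (θ : ℝ) :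
    ∑ j ∈ Finset.range (m + 1), fejerKorovkin m (θ + 2 * π * j / (m + 1 : ℕ)) *
        cos (θ + 2 * π * j / (m + 1 : ℕ)) =
      (m + 1) * cos (π / m) * ∑ k ∈ Finset.range m, sin (k * π / m) ^ 2 := by
  simp only [fejerKorovkin, Finset.sum_mul]
  rw [Finset.sum_comm, Finset.mul_sum]
  refine Finset.sum_congr rfl fun k hk => ?_
  rw [Finset.sum_comm]
  rw [Finset.mem_range] at hk
  have hm : (m : ℝ) ≠ 0 := by norm_cast; omega
  have : ∀ l ∈ Finset.range m, ∑ j ∈ Finset.range (m + 1), sin (k * π / m) * sin (l * π / m) *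
      cos (((k - l : ℤ) : ℝ) * (θ + 2 * π * j / (m + 1 : ℕ))) *
        cos (θ + 2 * π * j / (m + 1 : ℕ)) =
      (m + 1) / 2 * sin (k * π / m) * ((if k + 1 = l then sin (l * π / m) else 0) +
        if k = l + 1 then sin (l * π / m) else 0) := by
    intro l hl
    rw [Finset.mem_range] at hl
    have hprod : ∀ t : ℝ, sin (k * π / m) * sin (l * π / m) * cos (((k - l : ℤ) : ℝ) * t) * cos t =
        sin (k * π / m) * sin (l * π / m) / 2 *
          (cos (((k - l + 1 : ℤ) : ℝ) * t) + cos (((k - l - 1 : ℤ) : ℝ) * t)) := by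
      intro t
      rw [Int.cast_add, Int.cast_sub _ 1, add_mul, sub_mul, Int.cast_one, one_mul, cos_add, cos_sub]
      ring
    rw [Finset.sum_congr rfl fun j _ => hprod _, ← Finset.mul_sum, Finset.sum_add_distrib,
      sum_cos_int_mul_add_equispaced (by rw [abs_lt]; omega),
      sum_cos_int_mul_add_equispaced (by rw [abs_lt]; omega)]
    simp only [show ((k : ℤ) - l + 1 = 0) ↔ k + 1 = l by omega,
      show ((k : ℤ) - l - 1 = 0) ↔ k = l + 1 by omega]
    push_cast
    split_ifs <;> ring
  rw [Finset.sum_congr rfl this, ← Finset.mul_sum, Finset.sum_add_distrib]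
  have hup : ∑ l ∈ Finset.range m, (if k + 1 = l then sin (l * π / m) else 0) =
      sin (k * π / m + π / m) := by
    rw [Finset.sum_ite_eq]
    have e : (k * π / m + π / m : ℝ) = ((k + 1 : ℕ) : ℝ) * π / m := by push_cast; ring
    rw [e]
    split_ifs with h
    · rfl
    · have : k + 1 = m := by rw [Finset.mem_range] at h; omega
      rw [this, mul_div_cancel_left₀ _ hm, sin_pi]
  have hdown : sin (k * π / m) * ∑ l ∈ Finset.range m, (if k = l + 1 then sin (l * π / m) else 0) =
      sin (k * π / m) * sin (k * π / m - π / m) := by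
    rcases k with _ | k
    · simp
    · simp only [Nat.add_right_cancel_iff]
      rw [Finset.sum_ite_eq, if_pos (by rw [Finset.mem_range]; omega)]
      congr 2
      push_cast; ring
  have hrec := sin_add (k * π / m) (π / m)
  have hrec' := sin_sub (k * π / m) (π / m)
  rw [hup]
  linear_combination (m + 1 : ℝ) / 2 * hdown +
    (m + 1 : ℝ) / 2 * sin (k * π / m) * (hrec + hrec')

theorem sq_cos_sub_cos_le (x y : ℝ) : (cos x - cos y) ^ 2 ≤ 2 * (1 - cos (x - y)) := by
  rw [cos_sub]
  nlinarith [sin_sq_add_cos_sq x, sin_sq_add_cos_sq y, sq_nonneg (sin x - sin y)]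

theorem sum_sin_sq_pos {m : ℕ} (hm : 2 ≤ m) :
    0 < ∑ k ∈ Finset.range m, sin (k * π / m) ^ 2 := by
  refine Finset.sum_pos' (fun _ _ => sq_nonneg _) ⟨1, Finset.mem_range.2 hm, ?_⟩
  have hm' : (2 : ℝ) ≤ m := by exact_mod_cast hm
  refine pow_pos (sin_pos_of_pos_of_lt_pi (by positivity) ?_) 2
  rw [div_lt_iff₀ (by positivity)]
  push_cast
  nlinarith [pi_pos]

theorem sum_fejerKorovkin_mul_abs_cos_sub_cos_le {m : ℕ} (hm : 2 ≤ m) (θ : ℝ) :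
    ∑ j ∈ Finset.range (m + 1), fejerKorovkin m (θ + 2 * π * j / (m + 1 : ℕ)) *
        |cos (2 * π * j / (m + 1 : ℕ)) - cos θ| ≤
      (m + 1) * (∑ k ∈ Finset.range m, sin (k * π / m) ^ 2) * (π / m) := by
  set S := ∑ k ∈ Finset.range m, sin (k * π / m) ^ 2 with hS
  have hSpos : 0 < S := sum_sin_sq_pos hm
  have hδ : 0 < π / m := by positivity
  have hterm : ∀ j ∈ Finset.range (m + 1), fejerKorovkin m (θ + 2 * π * j / (m + 1 : ℕ)) *
        |cos (2 * π * j / (m + 1 : ℕ)) - cos θ| ≤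
      (1 / (π / m) + π / m / 2) * fejerKorovkin m (θ + 2 * π * j / (m + 1 : ℕ)) -
      1 / (π / m) * (fejerKorovkin m (θ + 2 * π * j / (m + 1 : ℕ)) *
        cos (θ + 2 * π * j / (m + 1 : ℕ))) := by
    intro j _
    have hK := fejerKorovkin_nonneg m (θ + 2 * π * j / (m + 1 : ℕ))
    have hsq := sq_cos_sub_cos_le (2 * π * j / (m + 1 : ℕ)) (-θ)
    rw [cos_neg, sub_neg_eq_add, add_comm _ θ, ← sq_abs] at hsq
    generalize |cos (2 * π * j / (m + 1 : ℕ)) - cos θ| = d at hsq ⊢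
    generalize cos (θ + 2 * π * j / (m + 1 : ℕ)) = c at hsq ⊢
    have hd : d ≤ 1 / (π / m) * (1 - c) + π / m / 2 := by
      rw [← sub_nonneg]
      have : 1 / (π / m) * (1 - c) + π / m / 2 - d =
          1 / (π / m) / 2 * (2 * (1 - c) - d ^ 2 + (d - π / m) ^ 2) := by
        field_simp; ring
      rw [this]
      have := sq_nonneg (d - π / m)
      exact mul_nonneg (by positivity) (by linarith)
    nlinarith [mul_le_mul_of_nonneg_left hd hK]
  refine (Finset.sum_le_sum hterm).trans ?_
  rw [Finset.sum_sub_distrib, ← Finset.mul_sum, ← Finset.mul_sum, sum_fejerKorovkin_equispaced,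
    sum_fejerKorovkin_mul_cos_equispaced, ← hS]
  have hcos := one_sub_sq_div_two_le_cos (x := π / m)
  have key : 1 / (π / m) * (1 - cos (π / m)) ≤ π / m / 2 := by
    rw [one_div, inv_mul_le_iff₀ hδ]; nlinarith
  have hP : 0 < (m + 1) * S := by positivity
  nlinarith [mul_le_mul_of_nonneg_left key hP.le]

/-- A Jackson-type theorem for a positive operator, so that the bound on `f` is preserved. -/
theorem exists_polynomial_abs_eval_sub_le {m : ℕ} (hm : 2 ≤ m) {f : ℝ → ℝ} {M : ℝ}
    (hM : ∀ x y, |f x - f y| ≤ M * |x - y|) {B : ℝ} (hf : ∀ x, |f x| ≤ B) :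
    ∃ P : ℝ[X], P.natDegree ≤ m - 1 ∧ ∀ x ∈ Icc (-1 : ℝ) 1,
      |P.eval x| ≤ B ∧ |P.eval x - f x| ≤ M * (π / m) := by
  set S := ∑ k ∈ Finset.range m, sin (k * π / m) ^ 2 with hS
  have hSpos : 0 < S := sum_sin_sq_pos hm
  have hC : 0 < (m + 1) * S := by positivity
  have hM0 : 0 ≤ M := by simpa using (abs_nonneg _).trans (hM 0 1)
  let φ : ℕ → ℝ := fun j => 2 * π * j / (m + 1 : ℕ)
  let w : ℝ → ℕ → ℝ := fun θ j => 1 / 2 * (fejerKorovkin m (θ + φ j) + fejerKorovkin m (-θ + φ j))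
  let P : ℝ[X] := ∑ j ∈ Finset.range (m + 1), ∑ k ∈ Finset.range m, ∑ l ∈ Finset.range m,
    C (((m + 1) * S)⁻¹ * f (cos (φ j)) * (sin (k * π / m) * sin (l * π / m) *
      cos (((k - l : ℤ) : ℝ) * φ j))) * Chebyshev.T ℝ (k - l)
  have hw : ∀ θ j, 0 ≤ w θ j := fun θ j =>
    mul_nonneg (by norm_num) (add_nonneg (fejerKorovkin_nonneg _ _) (fejerKorovkin_nonneg _ _))
  have hw_sum : ∀ θ, ∑ j ∈ Finset.range (m + 1), w θ j = (m + 1) * S := by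
    intro θ
    simp only [w, φ]
    rw [← Finset.mul_sum, Finset.sum_add_distrib, sum_fejerKorovkin_equispaced,
      sum_fejerKorovkin_equispaced, ← hS]
    ring
  have hw_dist : ∀ θ, ∑ j ∈ Finset.range (m + 1), w θ j * |cos (φ j) - cos θ| ≤
      (m + 1) * S * (π / m) := by
    intro θ
    have h1 := sum_fejerKorovkin_mul_abs_cos_sub_cos_le hm θ
    have h2 := sum_fejerKorovkin_mul_abs_cos_sub_cos_le hm (-θ)
    rw [cos_neg] at h2
    simp only [w, φ, mul_assoc (1 / 2 : ℝ), add_mul]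
    rw [← Finset.mul_sum, Finset.sum_add_distrib]
    linarith
  have hP : ∀ θ, (m + 1) * S * P.eval (cos θ) =
      ∑ j ∈ Finset.range (m + 1), w θ j * f (cos (φ j)) := by
    intro θ
    clear_value S
    simp only [P, eval_finsetSum, eval_mul, eval_C, Chebyshev.T_real_cos, Finset.mul_sum]
    refine Finset.sum_congr rfl fun j _ => ?_
    simp only [w, fejerKorovkin]
    rw [← Finset.sum_add_distrib, Finset.mul_sum, Finset.sum_mul]
    refine Finset.sum_congr rfl fun k _ => ?_
    rw [← Finset.sum_add_distrib, Finset.mul_sum, Finset.sum_mul]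
    refine Finset.sum_congr rfl fun l _ => ?_
    rw [mul_add _ θ, mul_add _ (-θ), cos_add, cos_add, mul_neg, cos_neg, sin_neg]
    field_simp
    ring
  refine ⟨P, ?_, fun x hx => ?_⟩
  · refine natDegree_sum_le_of_forall_le _ _ fun j _ =>
      natDegree_sum_le_of_forall_le _ _ fun k hk => natDegree_sum_le_of_forall_le _ _ fun l hl => ?_
    rw [Finset.mem_range] at hk hl
    refine (natDegree_C_mul_le _ _).trans ?_
    rw [Chebyshev.natDegree_T]
    omega
  · rw [← cos_arccos hx.1 hx.2]
    generalize arccos x = θ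
    constructor
    · rw [← mul_le_mul_iff_right₀ hC, ← abs_of_pos hC, ← abs_mul, abs_of_pos hC, hP]
      calc |∑ j ∈ Finset.range (m + 1), w θ j * f (cos (φ j))|
          ≤ ∑ j ∈ Finset.range (m + 1), w θ j * B := by
            refine (Finset.abs_sum_le_sum_abs _ _).trans (Finset.sum_le_sum fun j _ => ?_)
            rw [abs_mul, abs_of_nonneg (hw θ j)]
            exact mul_le_mul_of_nonneg_left (hf _) (hw θ j)
        _ = (m + 1) * S * B := by rw [← Finset.sum_mul, hw_sum]
    · rw [← mul_le_mul_iff_right₀ hC, ← abs_of_pos hC, ← abs_mul, abs_of_pos hC, mul_sub, hP,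
        ← hw_sum θ, Finset.sum_mul, ← Finset.sum_sub_distrib]
      calc |∑ j ∈ Finset.range (m + 1), (w θ j * f (cos (φ j)) - w θ j * f (cos θ))|
          ≤ ∑ j ∈ Finset.range (m + 1), M * (w θ j * |cos (φ j) - cos θ|) := by
            refine (Finset.abs_sum_le_sum_abs _ _).trans (Finset.sum_le_sum fun j _ => ?_)
            rw [← mul_sub, abs_mul, abs_of_nonneg (hw θ j), mul_left_comm]
            exact mul_le_mul_of_nonneg_left (hM _ _) (hw θ j)
        _ ≤ M * ((m + 1) * S * (π / m)) := by
            rw [← Finset.mul_sum]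
            exact mul_le_mul_of_nonneg_left (hw_dist θ) hM0
        _ = (∑ j ∈ Finset.range (m + 1), w θ j) * (M * (π / m)) := by rw [hw_sum]; ring

/-- Values in `[-1, 1]` prescribed on `σ`-separated sets extend to a `2 / σ`-Lipschitz function
with values in `[-1, 1]`. -/
theorem exists_lipschitz_extension_of_separated {ι : Type*} (I : ι → Set ℝ) {σ : ℝ} (hσ : 0 < σ)
    (hgap : ∀ i j, i ≠ j → ∀ x ∈ I i, ∀ t ∈ I j, σ ≤ |x - t|)
    (y : ι → ℝ) (hy : ∀ i, |y i| ≤ 1) :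
    ∃ f : ℝ → ℝ, (∀ x t, |f x - f t| ≤ 2 / σ * |x - t|) ∧ (∀ x, |f x| ≤ 1) ∧
      ∀ i, ∀ t ∈ I i, f t = y i := by
  classical
  let g : ℝ → ℝ := fun x => if h : ∃ i, x ∈ I i then y h.choose else 0
  have hg : ∀ i, ∀ t ∈ I i, g t = y i := by
    intro i t ht
    have h : ∃ i, t ∈ I i := ⟨i, ht⟩
    simp only [g, dif_pos h]
    by_contra hne
    have := hgap _ i (fun e => hne (by rw [e])) t h.choose_spec t ht
    simp at this
    linarith
  have hlip : LipschitzOnWith (2 / σ).toNNReal g (⋃ i, I i) := by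
    refine LipschitzOnWith.of_dist_le_mul fun x hx t ht => ?_
    obtain ⟨i, hi⟩ := mem_iUnion.1 hx
    obtain ⟨j, hj⟩ := mem_iUnion.1 ht
    rw [hg i x hi, hg j t hj, Real.coe_toNNReal _ (by positivity), Real.dist_eq, Real.dist_eq]
    by_cases hij : i = j
    · subst hij
      rw [sub_self, abs_zero]
      positivity
    · calc |y i - y j| ≤ |y i| + |y j| := abs_sub _ _
        _ ≤ 2 / σ * σ := by
          rw [div_mul_cancel₀ _ hσ.ne']; linarith [hy i, hy j]
        _ ≤ 2 / σ * |x - t| := by gcongr; exact hgap i j hij x hi t hj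
  obtain ⟨h, hh, hgh⟩ := hlip.extend_real
  refine ⟨fun x => max (-1) (min (h x) 1), fun x t => ?_, fun x => ?_, fun i t ht => ?_⟩
  · have := (hh.min_const 1).const_max (-1) |>.dist_le_mul x t
    rwa [Real.coe_toNNReal _ (by positivity), Real.dist_eq, Real.dist_eq] at this
  · rw [abs_le]
    exact ⟨le_max_left _ _, max_le (by norm_num) (min_le_right _ _)⟩
  · have hyi := abs_le.1 (hy i)
    simp only
    rw [← hgh (mem_iUnion.2 ⟨i, ht⟩), hg i t ht, min_eq_left hyi.2, max_eq_right hyi.1]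

theorem base_step_general_bound {s : ℕ} (a b : Fin s → ℝ) (σ : ℝ)
    (hsub : ∀ i, Set.Icc (a i) (b i) ⊆ Set.Icc (-1 : ℝ) 1)
    (hab : ∀ i, a i ≤ b i)
    (hdisj : Pairwise fun i j => Disjoint (Set.Icc (a i) (b i)) (Set.Icc (a j) (b j)))
    (hσ : 0 < σ)
    (hgap : ∀ i j : Fin s, i ≠ j → ∀ x ∈ Set.Icc (a i) (b i), ∀ t ∈ Set.Icc (a j) (b j),
      σ ≤ |x - t|)
    (y : Fin s → ℝ) (hy : ∀ i, y i = -1 ∨ y i = 1) :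
    ∃ P : Polynomial ℝ, P.natDegree ≤ ⌊4 * Real.pi / σ⌋₊ ∧
      (∀ t ∈ Set.Icc (-1 : ℝ) 1, |P.eval t| ≤ 1) ∧
      (∀ i, ∀ t ∈ Set.Icc (a i) (b i), |P.eval t - y i| ≤ 1 / 2) := by
  have hy1 : ∀ i, |y i| ≤ 1 := fun i => by rcases hy i with h | h <;> simp [h]
  rcases le_or_gt σ 2 with hσ2 | hσ2
  · obtain ⟨f, hfM, hf1, hfy⟩ :=
      exists_lipschitz_extension_of_separated (fun i => Icc (a i) (b i)) hσ hgap y hy1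
    have hn : 1 ≤ ⌊4 * π / σ⌋₊ := by
      rw [Nat.one_le_floor_iff, le_div_iff₀ hσ]
      linarith [pi_gt_three]
    obtain ⟨P, hdeg, hP⟩ :=
      exists_polynomial_abs_eval_sub_le (m := ⌊4 * π / σ⌋₊ + 1) (by omega) hfM hf1
    refine ⟨P, by simpa using hdeg, fun t ht => (hP t ht).1, fun i t ht => ?_⟩
    rw [← hfy i t ht]
    refine (hP t (hsub i ht)).2.trans ?_
    have hlt := Nat.lt_floor_add_one (4 * π / σ)
    rw [div_lt_iff₀ hσ] at hlt
    rw [div_mul_div_comm, div_le_div_iff₀ (by positivity) two_pos]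
    push_cast
    linarith
  · have heq : ∀ i j : Fin s, i = j := by
      intro i j
      by_contra hij
      have hi := hsub i (left_mem_Icc.2 (hab i))
      have hj := hsub j (left_mem_Icc.2 (hab j))
      have := hgap i j hij _ (left_mem_Icc.2 (hab i)) _ (left_mem_Icc.2 (hab j))
      have : |a i - a j| ≤ 2 := abs_le.2 ⟨by linarith [hi.1, hj.2], by linarith [hi.2, hj.1]⟩
      linarith
    rcases isEmpty_or_nonempty (Fin s) with he | ⟨⟨i₀⟩⟩
    · exact ⟨0, by simp, by simp, fun i => he.elim i⟩
    · refine ⟨C (y i₀), by simp, fun t _ => by simpa using hy1 i₀, fun i t _ => ?_⟩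
      rw [heq i i₀]
      simp
end

section
/- For 0 < δ < 1/4, ε_n({−1,1}; δ) ≤ 2·(4δ/(1+δ)²)^{n/2}, where ε_n({−1,1}; δ) is the smallest ε such that some real polynomial P of degree ≤ n satisfies |P(t) − 1| ≤ ε for t ∈ [1−δ, 1+δ] and |P(t) + 1| ≤ ε for t ∈ [−1−δ, −1+δ]. -/
open Polynomial Real

/-- The Taylor coefficients of `(1 - x) ^ (-1 / 2)` at `0`. -/
noncomputable def invSqrtCoeff (k : ℕ) : ℝ := k.centralBinom / 4 ^ k

theorem invSqrtCoeff_nonneg (k : ℕ) : 0 ≤ invSqrtCoeff k := by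
  unfold invSqrtCoeff
  positivity

theorem two_mul_succ_mul_invSqrtCoeff_succ (k : ℕ) :
    2 * ((k + 1 : ℝ) * invSqrtCoeff (k + 1)) = (2 * k + 1) * invSqrtCoeff k := by
  have h : ((k : ℝ) + 1) * (k + 1).centralBinom = 2 * (2 * k + 1) * k.centralBinom :=
    mod_cast Nat.succ_mul_centralBinom_succ k
  unfold invSqrtCoeff
  rw [pow_succ]
  field_simp
  linear_combination 2 * h

theorem one_sub_X_mul_mk_invSqrtCoeff_sq :
    (1 - PowerSeries.X) * PowerSeries.mk invSqrtCoeff ^ 2 = 1 := by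
  set f := PowerSeries.mk invSqrtCoeff with hf
  have hder : 2 * ((1 - PowerSeries.X) * PowerSeries.derivative ℝ f) = f := by
    have key : 2 * PowerSeries.derivative ℝ f
        = f + 2 * (PowerSeries.X * PowerSeries.derivative ℝ f) := by
      ext k
      rw [two_mul, two_mul]
      simp only [map_add]
      cases k with
      | zero =>
        have := two_mul_succ_mul_invSqrtCoeff_succ 0
        simp [hf, PowerSeries.coeff_derivative] at this ⊢
        linarith
      | succ k =>
        have := two_mul_succ_mul_invSqrtCoeff_succ (k + 1)
        rw [PowerSeries.coeff_succ_X_mul]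
        simp only [hf, PowerSeries.coeff_derivative, PowerSeries.coeff_mk]
        push_cast at this ⊢
        linarith
    linear_combination key
  apply PowerSeries.derivative.ext
  · simp only [Derivation.leibniz, Derivation.leibniz_pow, map_sub, PowerSeries.derivative_X,
      Derivation.map_one_eq_zero, smul_eq_mul, nsmul_eq_mul]
    push_cast
    linear_combination f * hder
  · simp [hf, invSqrtCoeff]

theorem sum_antidiagonal_invSqrtCoeff (k : ℕ) :
    ∑ p ∈ Finset.HasAntidiagonal.antidiagonal k, invSqrtCoeff p.1 * invSqrtCoeff p.2 = 1 := by
  have h : PowerSeries.mk invSqrtCoeff ^ 2 = PowerSeries.mk 1 := by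
    linear_combination (PowerSeries.mk (1 : ℕ → ℝ)) * one_sub_X_mul_mk_invSqrtCoeff_sq
      - PowerSeries.mk invSqrtCoeff ^ 2 * PowerSeries.mk_one_mul_one_sub_eq_one ℝ
  simpa [sq, PowerSeries.coeff_mul] using congrArg (PowerSeries.coeff k) h

theorem sum_biUnion_antidiagonal_invSqrtCoeff (N : ℕ) (u : ℝ) :
    ∑ p ∈ (Finset.range N).biUnion Finset.HasAntidiagonal.antidiagonal,
      (invSqrtCoeff p.1 * u ^ p.1) * (invSqrtCoeff p.2 * u ^ p.2) =
      ∑ k ∈ Finset.range N, u ^ k := by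
  rw [Finset.sum_biUnion]
  · refine Finset.sum_congr rfl fun k _ => ?_
    calc _ = ∑ p ∈ Finset.HasAntidiagonal.antidiagonal k,
            invSqrtCoeff p.1 * invSqrtCoeff p.2 * u ^ k := by
          refine Finset.sum_congr rfl fun p hp => ?_
          rw [← Finset.HasAntidiagonal.mem_antidiagonal.1 hp, pow_add]
          ring
      _ = u ^ k := by rw [← Finset.sum_mul, sum_antidiagonal_invSqrtCoeff, one_mul]
  · intro i _ j _ hij
    refine Finset.disjoint_left.2 fun p hi hj => hij ?_
    rw [← Finset.HasAntidiagonal.mem_antidiagonal.1 hi,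
      ← Finset.HasAntidiagonal.mem_antidiagonal.1 hj]

/-- The partial sums of the Taylor series of `(1 - x) ^ (-1 / 2)`, squared and multiplied by
`1 - x`, lie between `1 - x ^ m` and `1`. -/
theorem one_sub_mul_sum_invSqrtCoeff_sq_mem (m : ℕ) {u : ℝ} (hu0 : 0 ≤ u) (hu1 : u ≤ 1) :
    (1 - u) * (∑ k ∈ Finset.range m, invSqrtCoeff k * u ^ k) ^ 2 ∈ Set.Icc (1 - u ^ m) 1 := by
  have hnn (p : ℕ × ℕ) :
      0 ≤ (invSqrtCoeff p.1 * u ^ p.1) * (invSqrtCoeff p.2 * u ^ p.2) := by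
    have := invSqrtCoeff_nonneg p.1
    have := invSqrtCoeff_nonneg p.2
    positivity
  have hgeom (N : ℕ) : (1 - u) * ∑ k ∈ Finset.range N, u ^ k = 1 - u ^ N :=
    mul_neg_geom_sum u N
  rw [sq, Finset.sum_mul_sum, ← Finset.sum_product']
  constructor
  · rw [← hgeom, ← sum_biUnion_antidiagonal_invSqrtCoeff]
    refine mul_le_mul_of_nonneg_left ?_ (by linarith)
    refine Finset.sum_le_sum_of_subset_of_nonneg (fun p hp => ?_) fun p _ _ => hnn p
    simp only [Finset.mem_biUnion, Finset.mem_range, Finset.HasAntidiagonal.mem_antidiagonal,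
      Finset.mem_product] at hp ⊢
    omega
  · calc _ ≤ (1 - u) * ∑ k ∈ Finset.range (2 * m), u ^ k := by
          rw [← sum_biUnion_antidiagonal_invSqrtCoeff]
          refine mul_le_mul_of_nonneg_left ?_ (by linarith)
          refine Finset.sum_le_sum_of_subset_of_nonneg (fun p hp => ?_) fun p _ _ => hnn p
          simp only [Finset.mem_biUnion, Finset.mem_range, Finset.HasAntidiagonal.mem_antidiagonal,
            Finset.mem_product] at hp ⊢
          exact ⟨p.1 + p.2, by omega, rfl⟩
      _ ≤ 1 := by
          rw [hgeom]
          linarith [pow_nonneg hu0 (2 * m)]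

/-- An odd polynomial of degree at most `2 * m - 1` approximating the sign function, with error at
most `(1 - x ^ 2) ^ m` on `[-1, 1]`. -/
noncomputable def signApprox (m : ℕ) : ℝ[X] :=
  ∑ k ∈ Finset.range m, C (invSqrtCoeff k) * (X * (1 - X ^ 2) ^ k)

theorem natDegree_signApprox_le {m n : ℕ} (h : 2 * m ≤ n + 1) :
    (signApprox m).natDegree ≤ n := by
  refine natDegree_sum_le_of_forall_le _ _ fun k hk => ?_
  have hk := Finset.mem_range.1 hk
  have : (C (invSqrtCoeff k) * (X * (1 - X ^ 2) ^ k)).natDegree ≤ 0 + (1 + k * 2) := by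
    compute_degree
    omega
  omega

theorem eval_signApprox (m : ℕ) (x : ℝ) : (signApprox m).eval x =
    x * ∑ k ∈ Finset.range m, invSqrtCoeff k * (1 - x ^ 2) ^ k := by
  simp only [signApprox, eval_finsetSum, Finset.mul_sum]
  refine Finset.sum_congr rfl fun k _ => ?_
  simp only [eval_mul, eval_C, eval_X, eval_pow, eval_sub, eval_one]
  ring

theorem eval_neg_signApprox (m : ℕ) (x : ℝ) :
    (signApprox m).eval (-x) = -(signApprox m).eval x := by
  simp [eval_signApprox]

theorem abs_eval_signApprox_sub_one_le (m : ℕ) {x : ℝ} (hx0 : 0 ≤ x) (hx1 : x ≤ 1) :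
    |(signApprox m).eval x - 1| ≤ (1 - x ^ 2) ^ m := by
  have hu0 : 0 ≤ 1 - x ^ 2 := by nlinarith
  obtain ⟨hl, hr⟩ := one_sub_mul_sum_invSqrtCoeff_sq_mem m hu0 (by nlinarith)
  rw [sub_sub_cancel, ← mul_pow, ← eval_signApprox] at hl hr
  have hy0 : 0 ≤ (signApprox m).eval x := by
    rw [eval_signApprox]
    exact mul_nonneg hx0 (Finset.sum_nonneg fun k _ =>
      mul_nonneg (invSqrtCoeff_nonneg k) (pow_nonneg hu0 k))
  have hy1 : (signApprox m).eval x ≤ 1 := by nlinarith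
  rw [abs_le]
  constructor <;> nlinarith [pow_nonneg hu0 m]

theorem eps_n_sign_bound (δ : ℝ) (hδ0 : 0 < δ) (hδ : δ < 1 / 4) (n : ℕ) :
    ∃ P : Polynomial ℝ, P.natDegree ≤ n ∧
      (∀ t ∈ Set.Icc (1 - δ) (1 + δ),
        |P.eval t - 1| ≤ 2 * (4 * δ / (1 + δ) ^ 2) ^ ((n : ℝ) / 2)) ∧
      (∀ t ∈ Set.Icc (-1 - δ) (-1 + δ),
        |P.eval t + 1| ≤ 2 * (4 * δ / (1 + δ) ^ 2) ^ ((n : ℝ) / 2)) := by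
  set q := 4 * δ / (1 + δ) ^ 2 with hq
  have hq0 : 0 < q := by positivity
  have hq1 : q ≤ 1 := by
    rw [hq, div_le_one (by positivity)]
    nlinarith [sq_nonneg (1 - δ)]
  let m := (n + 1) / 2
  let P := (signApprox m).comp (C (1 + δ)⁻¹ * X)
  have heval (t : ℝ) : P.eval t = (signApprox m).eval ((1 + δ)⁻¹ * t) := by simp [P]
  have hpos : ∀ t ∈ Set.Icc (1 - δ) (1 + δ), |P.eval t - 1| ≤ 2 * q ^ ((n : ℝ) / 2) := by
    rintro t ⟨ht0, ht1⟩
    have hx0 : 0 ≤ (1 + δ)⁻¹ * t := mul_nonneg (by positivity) (by linarith)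
    have hx1 : (1 + δ)⁻¹ * t ≤ 1 := by
      rw [inv_mul_le_iff₀ (by positivity)]
      linarith
    have hxq : 1 - ((1 + δ)⁻¹ * t) ^ 2 ≤ q := by
      have : q - (1 - ((1 + δ)⁻¹ * t) ^ 2) = (t ^ 2 - (1 - δ) ^ 2) / (1 + δ) ^ 2 := by
        rw [hq]
        field_simp
        ring
      have : 0 ≤ (t ^ 2 - (1 - δ) ^ 2) / (1 + δ) ^ 2 :=
        div_nonneg (by nlinarith) (by positivity)
      linarith
    have hnm : (n : ℝ) / 2 ≤ m := by
      have : (n : ℝ) ≤ 2 * m := by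
        have : n ≤ 2 * m := by simp only [m]; omega
        exact_mod_cast this
      linarith
    calc |P.eval t - 1| ≤ (1 - ((1 + δ)⁻¹ * t) ^ 2) ^ m := by
          rw [heval]
          exact abs_eval_signApprox_sub_one_le m hx0 hx1
      _ ≤ q ^ m := pow_le_pow_left₀ (by nlinarith) hxq m
      _ = q ^ (m : ℝ) := (rpow_natCast q m).symm
      _ ≤ q ^ ((n : ℝ) / 2) := rpow_le_rpow_of_exponent_ge hq0 hq1 hnm
      _ ≤ 2 * q ^ ((n : ℝ) / 2) := by linarith [rpow_nonneg hq0.le ((n : ℝ) / 2)]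
  refine ⟨P, ?_, hpos, ?_⟩
  · calc P.natDegree ≤ (signApprox m).natDegree * (C (1 + δ)⁻¹ * X).natDegree :=
          natDegree_comp_le
      _ ≤ n * 1 := Nat.mul_le_mul (natDegree_signApprox_le (by simp only [m]; omega))
          (natDegree_C_mul_X _ (by positivity)).le
      _ = n := mul_one n
  · rintro t ⟨ht0, ht1⟩
    have h := hpos (-t) ⟨by linarith, by linarith⟩
    rw [heval, mul_neg, eval_neg_signApprox, ← heval, ← abs_neg] at h
    convert h using 2
    ring
end
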